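/- arXiv:1511.00954 — 5 statements merged into one kernel-verified Lean document; each statement's English description precedes it below -/
import Mathlib

section
/- Let K be a field of characteristic zero, let n be a positive integer, and let G be a finite subgroup of GL_n(K) acting linearly on the polynomial ring K[x_1,...,x_n]. Let θ_1,...,θ_n be G-invariant homogeneous polynomials of positive degrees d_1,...,d_n that are algebraically independent over K and such that K[x_1,...,x_n] is a finitely generated module over the subalgebra K[θ_1,...,θ_n]. Set t = (d_1·d_2···d_n)/|G|. Then the quotient ring K[x_1,...,x_n]/(θ_1,...,θ_n), with its induced G-action, is isomorphic as a module over the group algebra K[G] to the direct sum of t copies of the regular representation of G. -/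
open MvPolynomial

/-- The linear action of an invertible matrix `g` on polynomials: `p(x) ↦ p(g⁻¹ x)`,
i.e. the variable `xᵢ` is sent to the linear form `∑ⱼ (g⁻¹)ᵢⱼ xⱼ`. -/
noncomputable def matrixAct {K : Type*} [Field K] {n : ℕ}
    (g : Matrix.GeneralLinearGroup (Fin n) K) :
    MvPolynomial (Fin n) K →ₐ[K] MvPolynomial (Fin n) K :=
  aeval fun i => ∑ j, ((g⁻¹ : Matrix.GeneralLinearGroup (Fin n) K) : Matrix (Fin n) (Fin n) K) i j • X j

/-- weak regularity of a list modulo an ideal -/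
def StWR {R : Type*} [CommRing R] : Ideal R → List R → Prop
  | _, [] => True
  | I, a :: l => (∀ p, a * p ∈ I → p ∈ I) ∧ StWR (I ⊔ Ideal.span {a}) l

theorem StWR_append {R : Type*} [CommRing R] (I : Ideal R) (l l' : List R) :
    StWR I (l ++ l') ↔ StWR I l ∧ StWR (I ⊔ Ideal.ofList l) l' := by
  induction l generalizing I with
  | nil => simp [StWR]
  | cons a l ih =>
    simp only [List.cons_append, StWR, ih, Ideal.ofList_cons, sup_assoc, and_assoc]

theorem St_mem_sup_singleton {R : Type*} [CommRing R] {I : Ideal R} {a x : R} :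
    x ∈ I ⊔ Ideal.span {a} ↔ ∃ q, x - a * q ∈ I := by
  constructor
  · intro h
    obtain ⟨i, hi, c, hc, e⟩ := Submodule.mem_sup.mp h
    obtain ⟨q, rfl⟩ := Ideal.mem_span_singleton'.mp hc
    exact ⟨q, by rw [← e]; convert hi using 1; ring⟩
  · rintro ⟨q, hq⟩
    have : x = (x - a * q) + a * q := by ring
    rw [this]
    exact Submodule.add_mem_sup hq (Ideal.mul_mem_right _ _ (Ideal.mem_span_singleton_self a))

theorem StWR_perm {R : Type*} [CommRing R] [IsLocalRing R] [IsNoetherianRing R]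
    {l l' : List R} (h : l.Perm l') (hl : ∀ a ∈ l, a ∈ IsLocalRing.maximalIdeal R)
    (I : Ideal R) (hW : StWR I l) : StWR I l' := by
  induction h generalizing I with
  | nil => exact hW
  | cons a h ih =>
    exact ⟨hW.1, ih (fun b hb => hl b (by simp [hb])) _ hW.2⟩
  | trans h1 h2 ih1 ih2 =>
    exact ih2 (fun b hb => hl b (h1.mem_iff.mpr hb)) _ (ih1 hl _ hW)
  | swap b a l =>
    obtain ⟨h1, h2, h3⟩ := hW
    have ha : a ∈ IsLocalRing.maximalIdeal R := hl a (by simp)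
    refine ⟨?_, ?_, ?_⟩
    rotate_left
    · intro p hp
      obtain ⟨q, hq⟩ := St_mem_sup_singleton.mp hp
      have h4 : q ∈ I ⊔ Ideal.span {a} := by
        apply h2
        rw [St_mem_sup_singleton]
        exact ⟨p, by simpa using neg_mem hq⟩
      obtain ⟨r, hr⟩ := St_mem_sup_singleton.mp h4
      rw [St_mem_sup_singleton]
      refine ⟨r, h1 _ ?_⟩
      have : a * (p - b * r) = (a * p - b * q) + b * (q - a * r) := by ring
      rw [this]
      exact add_mem hq (Ideal.mul_mem_left _ _ hr)
    · rwa [sup_assoc, sup_comm (Ideal.span {b}), ← sup_assoc]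
    · -- Nakayama
      let N : Ideal R := 
        { carrier := {p | b * p ∈ I}
          add_mem' := by intro x y hx hy; simpa [mul_add] using add_mem hx hy
          zero_mem' := by simp
          smul_mem' := by
            intro c x hx
            have := I.mul_mem_left c hx
            simpa [mul_left_comm] using this }
      have hN : N ≤ I ⊔ Ideal.span {a} • N := by
        intro p hp
        have hp' : b * p ∈ I := hp
        obtain ⟨q, hq⟩ := St_mem_sup_singleton.mp (h2 p (Ideal.mem_sup_left hp'))
        have : p = (p - a * q) + a * q := by ring
        rw [this]
        refine Submodule.add_mem_sup hq (Submodule.smul_mem_smul (Ideal.mem_span_singleton_self a) ?_)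
        change b * q ∈ I
        apply h1
        have : a * (b * q) = b * p - b * (p - a * q) := by ring
        rw [this]
        exact sub_mem hp' (I.mul_mem_left _ hq)
      have := Submodule.le_of_le_smul_of_le_jacobson_bot (I := Ideal.span {a}) (N := I) (N' := N)
        (IsNoetherian.noetherian N) (by
          rw [Ideal.span_le, Set.singleton_subset_iff]
          exact IsLocalRing.maximalIdeal_le_jacobson _ ha) hN
      exact fun p hp => this hp

theorem St_exists_z {R : Type*} [CommRing R] [IsLocalRing R] [IsNoetherianRing R]
    (J J' : Ideal R) (a b : R) (ha : a ∈ IsLocalRing.maximalIdeal R) (hbm : b ∈ IsLocalRing.maximalIdeal R)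
    (hJ : ∀ p, a * p ∈ J → p ∈ J)
    (hJ' : IsLocalRing.maximalIdeal R ≤ (J' ⊔ Ideal.span {b}).radical) :
    ∃ z ∈ IsLocalRing.maximalIdeal R, (∀ p, z * p ∈ J → p ∈ J) ∧
      IsLocalRing.maximalIdeal R ≤ (J' ⊔ Ideal.span {z}).radical := by
  set m := IsLocalRing.maximalIdeal R with hm
  have f1 : (associatedPrimes R (R ⧸ J)).Finite := associatedPrimes.finite R _
  have f2 : (J'.minimalPrimes \ {m}).Finite :=
    (J'.finite_minimalPrimes_of_isNoetherianRing R).subset Set.sdiff_subset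
  have hf := f1.union f2
  have key : ¬ (m : Set R) ⊆ ⋃ P ∈ (associatedPrimes R (R ⧸ J) ∪ (J'.minimalPrimes \ {m})),
      ((id P : Ideal R) : Set R) := by
    rw [Ideal.subset_union_prime_finite hf ⊥ ⊥]
    · rintro ⟨P, hP | hP, hmP⟩
      · have hPm : P = m := ((IsLocalRing.maximalIdeal.isMaximal R).eq_of_le hP.1.ne_top hmP).symm
        have hz : a ∈ ⋃ P ∈ associatedPrimes R (R ⧸ J), (P : Set R) := by
          simp only [Set.mem_iUnion]
          exact ⟨P, hP, hPm ▸ ha⟩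
        rw [biUnion_associatedPrimes_eq_zero_divisors] at hz
        obtain ⟨x, hx0, hx⟩ := hz
        obtain ⟨p, rfl⟩ := Ideal.Quotient.mk_surjective x
        apply hx0
        rw [Ideal.Quotient.eq_zero_iff_mem]
        apply hJ
        rw [← Ideal.Quotient.eq_zero_iff_mem]
        exact hx
      · exact hP.2 ((IsLocalRing.maximalIdeal.isMaximal R).eq_of_le hP.1.1.1.ne_top hmP).symm
    · rintro P (hP | hP) - -
      · exact hP.1
      · exact hP.1.1.1
  rw [Set.not_subset] at key
  obtain ⟨z, hzm, hz⟩ := key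
  simp only [Set.mem_iUnion, not_exists, id] at hz
  refine ⟨z, hzm, ?_, ?_⟩
  · intro p hp
    by_contra hpJ
    have : z ∈ ⋃ P ∈ associatedPrimes R (R ⧸ J), (P : Set R) := by
      rw [biUnion_associatedPrimes_eq_zero_divisors]
      refine ⟨Ideal.Quotient.mk J p, by rwa [Ne, Ideal.Quotient.eq_zero_iff_mem], ?_⟩
      rw [← Ideal.Quotient.eq_zero_iff_mem] at hp
      exact hp
    simp only [Set.mem_iUnion] at this
    obtain ⟨P, hP, h⟩ := this
    exact hz P (Or.inl hP) h
  · rw [Ideal.radical_eq_sInf]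
    refine le_sInf ?_
    rintro P ⟨hP, hPp⟩
    have hJP : J' ≤ P := le_sup_left.trans hP
    have hPm : P ≤ m := IsLocalRing.le_maximalIdeal hPp.ne_top
    obtain ⟨Q, hQ, hQP⟩ := Ideal.exists_minimalPrimes_le hJP
    by_cases hQm : Q = m
    · exact hQm ▸ hQP
    have hzQ : z ∉ Q := hz Q (Or.inr ⟨hQ, hQm⟩)
    have hzP : z ∈ P := hP (Ideal.mem_sup_right (Ideal.mem_span_singleton_self z))
    have hQltP : Q < P := lt_of_le_of_ne hQP (fun h => hzQ (h ▸ hzP))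
    by_contra hcon
    have hPltm : P < m := lt_of_le_of_ne hPm (fun h => hcon h.ge)
    have hmax := IsLocalRing.maximalIdeal.isMaximal R
    have hb : m ∈ (J' ⊔ Ideal.span {b}).minimalPrimes := by
      by_cases htop : J' ⊔ Ideal.span {b} = ⊤
      · exfalso
        obtain ⟨q, hq⟩ := St_mem_sup_singleton.mp (htop ▸ Submodule.mem_top : (1:R) ∈ J' ⊔ Ideal.span {b})
        have h1 : (1 : R) ∈ m := by
          have : (1:R) = (1 - b * q) + b * q := by ring
          rw [this]
          exact add_mem (hPm (hJP hq)) (Ideal.mul_mem_right _ _ hbm)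
        exact hmax.ne_top ((Ideal.eq_top_iff_one _).mpr h1)
      refine ⟨⟨hmax.isPrime, IsLocalRing.le_maximalIdeal htop⟩, ?_⟩
      rintro P' ⟨hP', hle⟩ -
      exact hJ'.trans ((Ideal.IsPrime.radical_le_iff hP').mpr hle)
    have hht := Ideal.map_height_le_one_of_mem_minimalPrimes hb
    have hs := Ideal.Quotient.mk_surjective (I := J')
    have hc : ∀ P : Ideal R, J' ≤ P → (P.map (Ideal.Quotient.mk J')).comap (Ideal.Quotient.mk J') = P := by
      intro P hP
      rw [Ideal.comap_map_of_surjective _ hs]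
      simpa [← RingHom.ker_eq_comap_bot] using hP
    have hlt : ∀ P P' : Ideal R, J' ≤ P → P < P' →
        P.map (Ideal.Quotient.mk J') < P'.map (Ideal.Quotient.mk J') := by
      intro P P' h h'
      refine lt_of_le_of_ne (Ideal.map_mono h'.le) fun he => h'.ne ?_
      rw [← hc P h, ← hc P' (h.trans h'.le), he]
    have hpr : ∀ P : Ideal R, J' ≤ P → P.IsPrime → (P.map (Ideal.Quotient.mk J')).IsPrime := by
      intro P h hp
      exact Ideal.map_isPrime_of_surjective hs (by simpa using h)
    have := hpr Q hQ.1.2 hQ.1.1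
    have := hpr P hJP hPp
    have := hpr m (hJP.trans hPm) hmax.isPrime
    have i1 := Ideal.height_add_one_le_of_lt_of_isPrime (hlt Q P hQ.1.2 hQltP)
    have i2 := Ideal.height_add_one_le_of_lt_of_isPrime (hlt P m hJP hPltm)
    have i3 : (1 : ℕ∞) + 1 ≤ 1 := by
      refine le_trans ?_ hht
      refine le_trans ?_ i2
      gcongr
      refine le_trans ?_ i1
      exact le_add_self
    exact absurd i3 (by decide)

theorem StWR_exchange {R : Type*} [CommRing R] [IsLocalRing R] [IsNoetherianRing R] (n : ℕ) :
    ∀ (I : Ideal R) (as bs : List R), as.length = n → bs.length = n →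
    (∀ a ∈ as, a ∈ IsLocalRing.maximalIdeal R) → (∀ a ∈ bs, a ∈ IsLocalRing.maximalIdeal R) →
    StWR I as → IsLocalRing.maximalIdeal R ≤ (I ⊔ Ideal.ofList bs).radical → StWR I bs := by
  induction n with
  | zero =>
    intro I as bs h1 h2 _ _ _ _
    rw [List.length_eq_zero_iff] at h2
    subst h2; trivial
  | succ n ih =>
    intro I as bs h1 h2 ha hb hW hr
    obtain ⟨as, a, rfl⟩ : ∃ l a, as = l ++ [a] := ⟨as.dropLast, as.getLast (by aesop), (List.dropLast_append_getLast _).symm⟩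
    obtain ⟨bs, b, rfl⟩ : ∃ l a, bs = l ++ [a] := ⟨bs.dropLast, bs.getLast (by aesop), (List.dropLast_append_getLast _).symm⟩
    simp only [List.length_append, List.length_singleton, Nat.add_right_cancel_iff] at h1 h2
    rw [StWR_append] at hW
    rw [Ideal.ofList_append, Ideal.ofList_singleton, ← sup_assoc] at hr
    obtain ⟨z, hzm, hz, hzr⟩ := St_exists_z (I ⊔ Ideal.ofList as) (I ⊔ Ideal.ofList bs) a b
      (ha a (by simp)) (hb b (by simp)) hW.2.1 hr
    have w1 : StWR I (z :: as) := by
      refine StWR_perm (l := as ++ [z]) List.perm_append_comm ?_ I ?_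
      · intro x hx
        rcases List.mem_append.mp hx with h | h
        · exact ha x (by simp [h])
        · simp at h; exact h ▸ hzm
      · rw [StWR_append]; exact ⟨hW.1, hz, trivial⟩
    have w2 := ih (I ⊔ Ideal.span {z}) as bs h1 h2 (fun x hx => ha x (by simp [hx]))
      (fun x hx => hb x (by simp [hx])) w1.2 (by
        rwa [sup_assoc, sup_comm (Ideal.span {z}), ← sup_assoc])
    have w3 : StWR I (bs ++ [z]) := by
      refine StWR_perm (l := z :: bs) (List.perm_append_comm (l₁ := [z])) ?_ I ⟨w1.1, w2⟩
      intro x hx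
      rcases List.mem_cons.mp hx with h | h
      · exact h ▸ hzm
      · exact hb x (by simp [h])
    rw [StWR_append] at w3 ⊢
    refine ⟨w3.1, ?_, trivial⟩
    intro p hp
    obtain ⟨N, hN⟩ := hr hzm
    have hzN : z ^ N * p ∈ I ⊔ Ideal.ofList bs := by
      obtain ⟨q, hq⟩ := St_mem_sup_singleton.mp hN
      have : z ^ N * p = (z ^ N - b * q) * p + q * (b * p) := by ring
      rw [this]
      exact add_mem (Ideal.mul_mem_right _ _ hq) (Ideal.mul_mem_left _ _ hp)
    clear hN
    induction N with
    | zero => simpa using hzN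
    | succ N ihN =>
      apply ihN
      apply w3.2.1
      rwa [← mul_assoc, ← pow_succ']

theorem StWR_ofFn {R : Type*} [CommRing R] {n : ℕ} (f : Fin n → R) (I : Ideal R) :
    StWR I (List.ofFn f) ↔ ∀ k : Fin n, ∀ p, f k * p ∈ I ⊔ Ideal.span (f '' {i | i.val < k.val}) →
      p ∈ I ⊔ Ideal.span (f '' {i | i.val < k.val}) := by
  induction n generalizing I with
  | zero => simp [StWR]
  | succ n ih =>
    rw [List.ofFn_succ, StWR, ih, Fin.forall_fin_succ]
    have h0 : I ⊔ Ideal.span (f '' {i | i.val < (0 : Fin (n+1)).val}) = I := by simp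
    have hs : ∀ k : Fin n, I ⊔ Ideal.span (f '' {i | i.val < k.succ.val}) =
        I ⊔ Ideal.span {f 0} ⊔ Ideal.span ((fun i : Fin n => f i.succ) '' {i : Fin n | i.val < k.val}) := by
      intro k
      rw [sup_assoc, ← Ideal.span_union]
      congr 2
      ext x
      simp only [Set.mem_image, Set.mem_ofPred_eq, Set.mem_union, Set.mem_singleton_iff]
      rw [Fin.exists_fin_succ]
      simp [eq_comm]
    rw [h0]
    simp only [hs]

section
variable {K : Type*} [Field K] {n : ℕ}

theorem St_comp_mul {a p : MvPolynomial (Fin n) K} {d : ℕ} (ha : a.IsHomogeneous d) (j : ℕ) :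
    homogeneousComponent (j + d) (a * p) = a * homogeneousComponent j p := by
  let _ := MvPolynomial.gradedAlgebra (σ := Fin n) (R := K)
  have := DirectSum.coe_decompose_mul_add_of_left_mem (homogeneousSubmodule (Fin n) K)
    (a := a) (b := p) (i := d) (j := j) ha
  rw [add_comm, ← decomposition.decompose'_apply, ← decomposition.decompose'_apply]
  exact this

theorem St_comp_mul_lt {a p : MvPolynomial (Fin n) K} {d : ℕ} (ha : a.IsHomogeneous d) (j : ℕ)
    (hj : j < d) :
    homogeneousComponent j (a * p) = 0 := by
  let _ := MvPolynomial.gradedAlgebra (σ := Fin n) (R := K)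
  have := DirectSum.coe_decompose_mul_of_left_mem_of_not_le (homogeneousSubmodule (Fin n) K)
    (a := a) (b := p) (i := d) (n := j) ha (by omega)
  rw [← decomposition.decompose'_apply]
  exact this

/-- homogeneous ideal -/
def StHom (I : Ideal (MvPolynomial (Fin n) K)) : Prop :=
  ∀ p ∈ I, ∀ j, homogeneousComponent j p ∈ I

theorem StHom_span (s : Set (MvPolynomial (Fin n) K)) (hs : ∀ a ∈ s, ∃ d, a.IsHomogeneous d) :
    StHom (Ideal.span s) := by
  intro p hp j
  let _ := MvPolynomial.gradedAlgebra (σ := Fin n) (R := K)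
  have := Ideal.homogeneous_span (homogeneousSubmodule (Fin n) K) s
    (fun x hx => (hs x hx))
  rw [← decomposition.decompose'_apply]
  exact this j hp

theorem StHom_of_comp (I : Ideal (MvPolynomial (Fin n) K)) (p : MvPolynomial (Fin n) K)
    (h : ∀ j, homogeneousComponent j p ∈ I) : p ∈ I := by
  rw [← sum_homogeneousComponent p]
  exact sum_mem fun j _ => h j

theorem St_constCoeff_comp (u p : MvPolynomial (Fin n) K) (j : ℕ) (hp : p.IsHomogeneous j) :
    homogeneousComponent j (u * p) = C (constantCoeff u) * p := by
  have := St_comp_mul hp (p := u) 0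
  rw [zero_add, mul_comm] at this
  rw [this, homogeneousComponent_zero, mul_comm]; rfl

theorem St_X_reg (k : Fin n) (p : MvPolynomial (Fin n) K)
    (h : X k * p ∈ Ideal.span ((X : Fin n → MvPolynomial (Fin n) K) '' {i | i.val < k.val})) :
    p ∈ Ideal.span ((X : Fin n → MvPolynomial (Fin n) K) '' {i | i.val < k.val}) := by
  rw [mem_ideal_span_X_image] at h ⊢
  intro m hm
  obtain ⟨i, hi, hne⟩ := h (m + Finsupp.single k 1) (by
    rw [mem_support_iff, mul_comm, coeff_mul_X]
    exact mem_support_iff.mp hm)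
  refine ⟨i, hi, ?_⟩
  have : i ≠ k := by rintro rfl; simp at hi
  simpa [Finsupp.single_apply, this.symm] using hne

theorem St_theta_reg (θ : Fin n → MvPolynomial (Fin n) K) (d : Fin n → ℕ)
    (hhom : ∀ i, (θ i).IsHomogeneous (d i)) (hpos : ∀ i, 0 < d i)
    (hrad : ∀ i, X i ∈ (Ideal.span (Set.range θ)).radical)
    (k : Fin n) (p : MvPolynomial (Fin n) K)
    (h : θ k * p ∈ Ideal.span (θ '' {i | i.val < k.val})) :
    p ∈ Ideal.span (θ '' {i | i.val < k.val}) := by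
  let m : Ideal (MvPolynomial (Fin n) K) := RingHom.ker (constantCoeff : MvPolynomial (Fin n) K →+* K)
  have hmprime : m.IsPrime := RingHom.ker_isPrime _
  have hmX : m = Ideal.span (Set.range X) := by
    ext q
    rw [RingHom.mem_ker, ← Set.image_univ, mem_ideal_span_X_image]
    constructor
    · intro hq s hs
      by_contra hcon
      push Not at hcon
      have : s = 0 := by ext i; simpa using hcon i (by simp)
      subst this
      exact (mem_support_iff.mp hs) hq
    · intro hq
      by_contra hne
      obtain ⟨i, -, hi⟩ := hq 0 (mem_support_iff.mpr hne)
      simp at hi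
  let R := Localization.AtPrime m
  let φ : MvPolynomial (Fin n) K →+* R := algebraMap _ R
  have hφm : ∀ x ∈ m, φ x ∈ IsLocalRing.maximalIdeal R := by
    intro x hx
    rw [← Localization.AtPrime.map_eq_maximalIdeal]
    exact Ideal.mem_map_of_mem _ hx
  have hθm : ∀ i, θ i ∈ m := by
    intro i
    rw [RingHom.mem_ker]
    exact (hhom i).coeff_eq_zero (d := 0) (by simpa using (hpos i).ne)
  have hmem : ∀ (s : Set (MvPolynomial (Fin n) K)) (x : MvPolynomial (Fin n) K), φ x ∈ Ideal.span (φ '' s) → ∃ u ∉ m, u * x ∈ Ideal.span s := by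
    intro s x hx
    rw [← Ideal.map_span, IsLocalization.algebraMap_mem_map_algebraMap_iff m.primeCompl] at hx
    obtain ⟨u, hu, h⟩ := hx
    exact ⟨u, hu, h⟩
  have w1 : StWR (⊥ : Ideal R) (List.ofFn fun i => φ (X i)) := by
    rw [StWR_ofFn]
    intro k p hp
    rw [bot_sup_eq] at hp ⊢
    obtain ⟨x, s, rfl⟩ := IsLocalization.exists_mk'_eq m.primeCompl p
    have e : (fun i => φ (X i)) '' {i | i.val < k.val} = φ '' (X '' {i | i.val < k.val}) := by
      rw [Set.image_image]
    rw [e] at hp ⊢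
    have h2 : φ (X k * x) ∈ Ideal.span (φ '' (X '' {i : Fin n | i.val < k.val})) := by
      have := Ideal.mul_mem_left _ (φ s) hp
      convert this using 1
      rw [map_mul, mul_left_comm, mul_comm (φ s), IsLocalization.mk'_spec]
    obtain ⟨u, hu, hux⟩ := hmem _ _ h2
    rw [mul_left_comm] at hux
    have h3 := St_X_reg k _ hux
    rw [← Ideal.map_span, IsLocalization.mk'_mem_map_algebraMap_iff m.primeCompl]
    exact ⟨u, hu, h3⟩
  have w2 : StWR (⊥ : Ideal R) (List.ofFn fun i => φ (θ i)) := by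
    refine StWR_exchange n ⊥ _ _ (by simp) (by simp) ?_ ?_ w1 ?_
    · intro a ha
      obtain ⟨i, rfl⟩ := List.mem_ofFn.mp ha
      exact hφm _ (by simp [m])
    · intro a ha
      obtain ⟨i, rfl⟩ := List.mem_ofFn.mp ha
      exact hφm _ (hθm i)
    · have e : Ideal.ofList (List.ofFn fun i => φ (θ i)) = (Ideal.span (Set.range θ)).map φ := by
        rw [Ideal.map_span, ← Set.range_comp, Ideal.ofList]
        congr 1
        ext x
        simp [List.mem_ofFn]
      rw [bot_sup_eq, e, ← Localization.AtPrime.map_eq_maximalIdeal]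
      change m.map φ ≤ _
      have hmX' : m.map φ = (Ideal.span (Set.range X)).map φ := by rw [← hmX]
      rw [hmX', Ideal.map_span, Ideal.span_le]
      rintro _ ⟨_, ⟨i, rfl⟩, rfl⟩
      exact Ideal.map_radical_le _ (Ideal.mem_map_of_mem _ (hrad i))
  rw [StWR_ofFn] at w2
  have hH := StHom_span (θ '' {i | i.val < k.val}) (by
    rintro _ ⟨i, -, rfl⟩; exact ⟨_, hhom i⟩)
  apply StHom_of_comp
  intro j
  have h1 : θ k * homogeneousComponent j p ∈ Ideal.span (θ '' {i | i.val < k.val}) := by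
    rw [← St_comp_mul (hhom k)]; exact hH _ h _
  have h2 := w2 k (φ (homogeneousComponent j p)) (by
    rw [bot_sup_eq, ← map_mul, ← Set.image_image φ θ, ← Ideal.map_span]
    exact Ideal.mem_map_of_mem _ h1)
  rw [bot_sup_eq, ← Set.image_image φ θ] at h2
  obtain ⟨u, hu, hux⟩ := hmem _ _ h2
  have h3 := hH _ hux j
  rw [St_constCoeff_comp _ _ _ (homogeneousComponent_isHomogeneous j p)] at h3
  have h4 := Ideal.mul_mem_left _ (C (constantCoeff u)⁻¹) h3
  rwa [← mul_assoc, ← C_mul, inv_mul_cancel₀ (by simpa [m] using hu), C_1, one_mul] at h4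

end

section
variable {K : Type*} [Field K] {n : ℕ}

theorem St_finrank_inf_ker {S W : Type*} [AddCommGroup S] [Module K S] [AddCommGroup W] [Module K W]
    (f : S →ₗ[K] W) (P : Submodule K S) [FiniteDimensional K P] (h : P.map f = ⊤) :
    Module.finrank K (P ⊓ LinearMap.ker f : Submodule K S) + Module.finrank K W =
      Module.finrank K P := by
  have h1 := LinearMap.finrank_range_add_finrank_ker (f.domRestrict P)
  rw [LinearMap.range_domRestrict, h, finrank_top, LinearMap.ker_domRestrict] at h1
  rw [← h1, add_comm]
  congr 1
  rw [← Submodule.map_comap_subtype]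
  exact (LinearEquiv.finrank_eq (Submodule.equivMapOfInjective P.subtype P.injective_subtype _)).symm

/-- The first ideals -/
noncomputable def StI (θ : Fin n → MvPolynomial (Fin n) K) (k : ℕ) : Ideal (MvPolynomial (Fin n) K) :=
  Ideal.span (θ '' {i | i.val < k})

/-- The intersections -/
noncomputable def Sta (θ : Fin n → MvPolynomial (Fin n) K) (k N : ℕ) : ℕ :=
  Module.finrank K (restrictTotalDegree (Fin n) K N ⊓ (StI θ k).restrictScalars K :
    Submodule K (MvPolynomial (Fin n) K))

instance (N : ℕ) : FiniteDimensional K (restrictTotalDegree (Fin n) K N) := by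
  infer_instance

theorem StI_succ (θ : Fin n → MvPolynomial (Fin n) K) (k : Fin n) :
    StI θ (k.val + 1) = StI θ k.val ⊔ Ideal.span {θ k} := by
  rw [StI, StI, ← Ideal.span_union, ← Set.image_singleton, ← Set.image_union]
  congr 2
  ext i
  simp only [Set.mem_ofPred_eq, Set.mem_union, Set.mem_singleton_iff, Fin.ext_iff]
  omega

theorem StI_hom (θ : Fin n → MvPolynomial (Fin n) K) (d : Fin n → ℕ)
    (hhom : ∀ i, (θ i).IsHomogeneous (d i)) (k : ℕ) : StHom (StI θ k) :=
  StHom_span _ (by rintro _ ⟨i, -, rfl⟩; exact ⟨_, hhom i⟩)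

theorem St_decomp (θ : Fin n → MvPolynomial (Fin n) K) (d : Fin n → ℕ)
    (hhom : ∀ i, (θ i).IsHomogeneous (d i)) (k : Fin n) (N : ℕ) (p : MvPolynomial (Fin n) K)
    (hp : p.totalDegree ≤ N) (hpI : p ∈ StI θ (k.val + 1)) :
    ∃ i q, i ∈ StI θ k.val ∧ i.totalDegree ≤ N ∧ p = i + θ k * q ∧
      (N < d k → q = 0) ∧ q.totalDegree ≤ N - d k := by
  rw [StI_succ, St_mem_sup_singleton] at hpI
  obtain ⟨q, hq⟩ := hpI
  have hH := StI_hom θ d hhom k.val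
  refine ⟨∑ j ∈ Finset.range (N + 1), homogeneousComponent j (p - θ k * q),
    ∑ j ∈ Finset.range (N + 1 - d k), homogeneousComponent j q, ?_, ?_, ?_, ?_, ?_⟩
  · exact sum_mem fun j _ => hH _ hq j
  · refine totalDegree_finsetSum_le fun j hj => ?_
    refine (homogeneousComponent_isHomogeneous j _).totalDegree_le.trans ?_
    have := Finset.mem_range.mp hj; omega
  · have h1 : p = ∑ j ∈ Finset.range (N + 1), homogeneousComponent j p := by
      conv_lhs => rw [← sum_homogeneousComponent p]
      refine Finset.sum_subset (Finset.range_mono (by omega)) ?_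
      intro j _ hj
      exact homogeneousComponent_eq_zero _ _ (by simpa using hj)
    have h2 : θ k * ∑ j ∈ Finset.range (N + 1 - d k), homogeneousComponent j q =
        ∑ j ∈ Finset.range (N + 1), homogeneousComponent j (θ k * q) := by
      rw [Finset.mul_sum]
      by_cases hN : d k ≤ N + 1
      · conv_rhs => rw [← Nat.sub_add_cancel hN, add_comm, Finset.sum_range_add]
        have hz : ∑ x ∈ Finset.range (d k), homogeneousComponent x (θ k * q) = 0 :=
          Finset.sum_eq_zero fun j hj => St_comp_mul_lt (hhom k) j (Finset.mem_range.mp hj)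
        rw [hz, zero_add]
        exact Finset.sum_congr rfl fun j _ => by rw [add_comm, St_comp_mul (hhom k)]
      · rw [Nat.sub_eq_zero_of_le (by omega), Finset.sum_range_zero, Finset.sum_eq_zero]
        intro j hj
        have := Finset.mem_range.mp hj
        exact St_comp_mul_lt (hhom k) j (by omega)
    rw [h2, ← Finset.sum_add_distrib]
    conv_lhs => rw [h1]
    exact Finset.sum_congr rfl fun j _ => by rw [← map_add]; congr 1; ring
  · intro h
    rw [Nat.sub_eq_zero_of_le (by omega), Finset.sum_range_zero]
  · refine totalDegree_finsetSum_le fun j hj => ?_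
    refine (homogeneousComponent_isHomogeneous j _).totalDegree_le.trans ?_
    have := Finset.mem_range.mp hj; omega

theorem Sta_lt (θ : Fin n → MvPolynomial (Fin n) K) (d : Fin n → ℕ)
    (hhom : ∀ i, (θ i).IsHomogeneous (d i)) (k : Fin n) (N : ℕ) (hN : N < d k) :
    Sta θ (k.val + 1) N = Sta θ k.val N := by
  have key : (restrictTotalDegree (Fin n) K N ⊓ (StI θ (k.val + 1)).restrictScalars K :
      Submodule K (MvPolynomial (Fin n) K)) =
      restrictTotalDegree (Fin n) K N ⊓ (StI θ k.val).restrictScalars K := by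
    refine le_antisymm ?_ ?_
    · rintro p ⟨hp, hpI⟩
      rw [SetLike.mem_coe, mem_restrictTotalDegree] at hp
      obtain ⟨i, q, hi, hiN, e, hq, -⟩ := St_decomp θ d hhom k N p hp hpI
      rw [hq hN, mul_zero, add_zero] at e
      subst e
      exact ⟨(mem_restrictTotalDegree _ _ _).mpr hp, hi⟩
    · refine inf_le_inf le_rfl ?_
      intro p hp
      change p ∈ StI θ (k.val + 1)
      rw [StI_succ]
      exact Ideal.mem_sup_left hp
  unfold Sta
  rw [key]

theorem Sta_ge (θ : Fin n → MvPolynomial (Fin n) K) (d : Fin n → ℕ)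
    (hhom : ∀ i, (θ i).IsHomogeneous (d i)) (h0 : ∀ i, θ i ≠ 0)
    (hreg : ∀ (k : Fin n) p, θ k * p ∈ StI θ k.val → p ∈ StI θ k.val)
    (k : Fin n) (N : ℕ) :
    Sta θ (k.val + 1) (N + d k) + Sta θ k.val N = Sta θ k.val (N + d k) +
      Module.finrank K (restrictTotalDegree (Fin n) K N) := by
  let μ : MvPolynomial (Fin n) K →ₗ[K] MvPolynomial (Fin n) K := LinearMap.mulLeft K (θ k)
  have hμ : Function.Injective μ := fun x y h => mul_left_cancel₀ (h0 k) h
  have hfr : ∀ P : Submodule K (MvPolynomial (Fin n) K),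
      Module.finrank K (P.map μ) = Module.finrank K P := fun P =>
    (LinearEquiv.finrank_eq (Submodule.equivMapOfInjective μ hμ P)).symm
  have hdeg : ∀ q : MvPolynomial (Fin n) K, (θ k * q).totalDegree ≤ N + d k ↔ q.totalDegree ≤ N := by
    intro q
    by_cases hq : q = 0
    · simp [hq]
    rw [totalDegree_mul_of_isDomain (h0 k) hq, (hhom k).totalDegree (h0 k)]
    omega
  have e1 : (restrictTotalDegree (Fin n) K (N + d k) ⊓ (StI θ (k.val+1)).restrictScalars K :
      Submodule K (MvPolynomial (Fin n) K)) =
      (restrictTotalDegree (Fin n) K (N + d k) ⊓ (StI θ k.val).restrictScalars K) ⊔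
      (restrictTotalDegree (Fin n) K N).map μ := by
    refine le_antisymm ?_ (sup_le ?_ ?_)
    · rintro p ⟨hp, hpI⟩
      rw [SetLike.mem_coe, mem_restrictTotalDegree] at hp
      obtain ⟨i, q, hi, hiN, e, -, hq⟩ := St_decomp θ d hhom k _ p hp hpI
      rw [e]
      refine Submodule.add_mem_sup ⟨(mem_restrictTotalDegree _ _ _).mpr hiN, hi⟩ 
        ⟨q, (mem_restrictTotalDegree _ _ _).mpr (by simpa using hq), rfl⟩
    · refine inf_le_inf le_rfl ?_
      intro p hp
      change p ∈ StI θ (k.val + 1)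
      rw [StI_succ]
      exact Ideal.mem_sup_left hp
    · rintro _ ⟨q, hq, rfl⟩
      rw [SetLike.mem_coe, mem_restrictTotalDegree] at hq
      refine ⟨(mem_restrictTotalDegree _ _ _).mpr ((hdeg q).mpr hq), ?_⟩
      change θ k * q ∈ StI θ (k.val + 1)
      rw [StI_succ]
      exact Ideal.mem_sup_right (Ideal.mul_mem_right _ _ (Ideal.mem_span_singleton_self _))
  have e2 : (restrictTotalDegree (Fin n) K (N + d k) ⊓ (StI θ k.val).restrictScalars K) ⊓
      (restrictTotalDegree (Fin n) K N).map μ = 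
      (restrictTotalDegree (Fin n) K N ⊓ (StI θ k.val).restrictScalars K).map μ := by
    refine le_antisymm ?_ ?_
    · rintro _ ⟨⟨h1, h2⟩, ⟨q, hq, rfl⟩⟩
      exact ⟨q, ⟨hq, hreg k q h2⟩, rfl⟩
    · rintro _ ⟨q, ⟨hq, hqI⟩, rfl⟩
      refine ⟨⟨(mem_restrictTotalDegree _ _ _).mpr ((hdeg q).mpr ((mem_restrictTotalDegree _ _ _).mp hq)),
        Ideal.mul_mem_left _ _ hqI⟩, ⟨q, hq, rfl⟩⟩
  have := Submodule.finrank_sup_add_finrank_inf_eq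
    (restrictTotalDegree (Fin n) K (N + d k) ⊓ (StI θ k.val).restrictScalars K)
    ((restrictTotalDegree (Fin n) K N).map μ)
  rw [e2, ← e1, hfr, hfr] at this
  exact this

/-- The Hilbert series -/
noncomputable def StH (θ : Fin n → MvPolynomial (Fin n) K) (k : ℕ) : PowerSeries ℤ :=
  PowerSeries.mk fun N => (Module.finrank K (restrictTotalDegree (Fin n) K N) : ℤ) - Sta θ k N

theorem StH_succ (θ : Fin n → MvPolynomial (Fin n) K) (d : Fin n → ℕ)
    (hhom : ∀ i, (θ i).IsHomogeneous (d i)) (h0 : ∀ i, θ i ≠ 0)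
    (hreg : ∀ (k : Fin n) p, θ k * p ∈ StI θ k.val → p ∈ StI θ k.val) (k : Fin n) :
    StH θ (k.val + 1) = (1 - PowerSeries.X ^ d k) * StH θ k.val := by
  ext N
  rw [sub_mul, one_mul, map_sub, PowerSeries.coeff_X_pow_mul']
  simp only [StH, PowerSeries.coeff_mk]
  split_ifs with h
  · obtain ⟨M, rfl⟩ := Nat.exists_eq_add_of_le' h
    have := Sta_ge θ d hhom h0 hreg k M
    rw [Nat.add_sub_cancel]
    zify at this
    linarith
  · rw [Sta_lt θ d hhom k N (by omega)]; ring

theorem StH_n (θ : Fin n → MvPolynomial (Fin n) K) (d : Fin n → ℕ)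
    (hhom : ∀ i, (θ i).IsHomogeneous (d i)) (h0 : ∀ i, θ i ≠ 0)
    (hreg : ∀ (k : Fin n) p, θ k * p ∈ StI θ k.val → p ∈ StI θ k.val) :
    StH θ n = (∏ i, (1 - PowerSeries.X ^ d i)) *
      PowerSeries.mk fun N => (Module.finrank K (restrictTotalDegree (Fin n) K N) : ℤ) := by
  have key : ∀ k ≤ n, StH θ k = (∏ i : Fin n with i.val < k, (1 - PowerSeries.X ^ d i)) *
      PowerSeries.mk fun N => (Module.finrank K (restrictTotalDegree (Fin n) K N) : ℤ) := by
    intro k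
    induction k with
    | zero =>
      intro _
      have e0 : θ '' {i | i.val < 0} = ∅ := by
        rw [Set.image_eq_empty]; ext i; simp
      have e1 : StI θ 0 = ⊥ := by rw [StI, e0, Ideal.span_empty]
      have e2 : ∀ N, Sta θ 0 N = 0 := by
        intro N
        unfold Sta
        rw [e1, Submodule.restrictScalars_bot, inf_bot_eq, finrank_bot]
      simp [StH, e2]
    | succ k ih =>
      intro hk
      rw [StH_succ θ d hhom h0 hreg ⟨k, hk⟩, ih (by omega), ← mul_assoc]
      congr 1
      have : (Finset.univ.filter fun i : Fin n => i.val < k + 1) =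
          insert ⟨k, hk⟩ (Finset.univ.filter fun i : Fin n => i.val < k) := by
        ext i; simp only [Finset.mem_filter, Finset.mem_univ, true_and, Finset.mem_insert, Fin.ext_iff]; omega
      rw [this, Finset.prod_insert (by simp)]
  rw [key n le_rfl, Finset.filter_true_of_mem (by simp)]

theorem St_ker_const : LinearMap.ker ((aeval (fun _ : Fin n => (0:K))).toLinearMap :
    MvPolynomial (Fin n) K →ₗ[K] K) = (StI (X : Fin n → MvPolynomial (Fin n) K) n).restrictScalars K := by
  ext q
  have : q ∈ LinearMap.ker ((aeval (fun _ : Fin n => (0:K))).toLinearMap :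
    MvPolynomial (Fin n) K →ₗ[K] K) ↔ constantCoeff q = 0 := by
    simp [LinearMap.mem_ker, aeval_zero']
  rw [this, Submodule.restrictScalars_mem, StI, mem_ideal_span_X_image]
  constructor
  · intro hq s hs
    by_contra hcon
    push Not at hcon
    have : s = 0 := by ext i; simpa using hcon i (by simp)
    subst this
    exact (mem_support_iff.mp hs) hq
  · intro hq
    by_contra hne
    obtain ⟨i, -, hi⟩ := hq 0 (mem_support_iff.mpr hne)
    simp at hi

theorem StH_X : StH (X : Fin n → MvPolynomial (Fin n) K) n = PowerSeries.mk fun _ => 1 := by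
  ext N
  simp only [StH, PowerSeries.coeff_mk, Sta]
  rw [← St_ker_const, ← St_finrank_inf_ker ((aeval (fun _ : Fin n => (0:K))).toLinearMap)
    (restrictTotalDegree (Fin n) K N)]
  · simp
  · rw [eq_top_iff]
    rintro c -
    exact ⟨C c, (mem_restrictTotalDegree _ _ _).mpr (by simp), by simp⟩

theorem St_finrank_quot (θ : Fin n → MvPolynomial (Fin n) K) (d : Fin n → ℕ)
    (hhom : ∀ i, (θ i).IsHomogeneous (d i)) (h0 : ∀ i, θ i ≠ 0)
    (hreg : ∀ (k : Fin n) p, θ k * p ∈ StI θ k.val → p ∈ StI θ k.val)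
    [FiniteDimensional K (MvPolynomial (Fin n) K ⧸ Ideal.span (Set.range θ))] :
    Module.finrank K (MvPolynomial (Fin n) K ⧸ Ideal.span (Set.range θ)) = ∏ i, d i := by
  have h1 := StH_n θ d hhom h0 hreg
  have h2 := StH_n (X : Fin n → MvPolynomial (Fin n) K) (fun _ => 1) (fun i => isHomogeneous_X _ i)
    (fun i => X_ne_zero i) (fun k p h => St_X_reg k p h)
  rw [StH_X] at h2
  let Q : Polynomial ℤ := ∏ i, ∑ j ∈ Finset.range (d i), Polynomial.X ^ j
  have h3 : StH θ n = (Q : PowerSeries ℤ) * PowerSeries.mk fun _ => 1 := by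
    rw [h1, h2, ← mul_assoc]
    congr 1
    have : (Q : PowerSeries ℤ) = ∏ i, ∑ j ∈ Finset.range (d i), PowerSeries.X ^ j := by
      change Polynomial.coeToPowerSeries.ringHom Q = _
      simp [Q, map_prod, map_sum]
    rw [this, ← Finset.prod_mul_distrib]
    refine Finset.prod_congr rfl fun i _ => ?_
    rw [pow_one, geom_sum_mul_neg]
  let f : MvPolynomial (Fin n) K →ₗ[K] (MvPolynomial (Fin n) K ⧸ Ideal.span (Set.range θ)) :=
    (Ideal.Quotient.mkₐ K _).toLinearMap
  have hker : LinearMap.ker f = (StI θ n).restrictScalars K := by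
    ext p
    have : θ '' {i | i.val < n} = Set.range θ := by
      rw [← Set.image_univ]; congr 1; ext i; simp
    rw [Submodule.restrictScalars_mem, StI, this, LinearMap.mem_ker]
    exact Ideal.Quotient.eq_zero_iff_mem
  obtain ⟨N0, hN0⟩ : ∃ N0, ∀ N ≥ N0, (restrictTotalDegree (Fin n) K N).map f = ⊤ := by
    obtain ⟨s, hs⟩ := Module.Finite.fg_top (R := K)
      (M := MvPolynomial (Fin n) K ⧸ Ideal.span (Set.range θ))
    choose g hg using Ideal.Quotient.mk_surjective (I := Ideal.span (Set.range θ))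
    refine ⟨s.sup fun v => (g v).totalDegree, fun N hN => ?_⟩
    rw [eq_top_iff, ← hs, Submodule.span_le]
    intro v hv
    exact ⟨g v, (mem_restrictTotalDegree _ _ _).mpr
      ((Finset.le_sup (f := fun v => (g v).totalDegree) hv).trans hN), hg v⟩
  have h4 := congrArg (PowerSeries.coeff (max N0 Q.natDegree)) h3
  have h5 := St_finrank_inf_ker f _ (hN0 (max N0 Q.natDegree) (le_max_left _ _))
  rw [hker] at h5
  rw [PowerSeries.coeff_mul, Finset.Nat.sum_antidiagonal_eq_sum_range_succ_mk] at h4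
  simp only [StH, PowerSeries.coeff_mk, Sta, mul_one, Polynomial.coeff_coe] at h4
  have h6 : Q.eval 1 = ∑ k ∈ Finset.range (max N0 Q.natDegree).succ, Q.coeff k := by
    rw [Polynomial.eval_eq_sum_range' (n := (max N0 Q.natDegree).succ)]
    · simp
    · exact Nat.lt_succ_of_le (le_max_right _ _)
  rw [← h6, ← h5] at h4
  have h7 : Q.eval 1 = ∏ i, (d i : ℤ) := by simp [Q, Polynomial.eval_prod, Polynomial.eval_finsetSum]
  rw [h7] at h4
  push_cast at h4
  zify
  linarith

end

section
variable {K : Type*} [Field K] {n : ℕ}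

theorem StI_n (θ : Fin n → MvPolynomial (Fin n) K) : StI θ n = Ideal.span (Set.range θ) := by
  have : θ '' {i | i.val < n} = Set.range θ := by
    rw [← Set.image_univ]; congr 1; ext i; simp
  rw [StI, this]

theorem StI_zero (θ : Fin n → MvPolynomial (Fin n) K) : StI θ 0 = ⊥ := by
  have e0 : θ '' {i | i.val < 0} = ∅ := by
    rw [Set.image_eq_empty]; ext i; simp
  rw [StI, e0, Ideal.span_empty]

theorem St_mem_IXn (q : MvPolynomial (Fin n) K) :
    q ∈ StI (X : Fin n → MvPolynomial (Fin n) K) n ↔ constantCoeff q = 0 := by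
  have : q ∈ LinearMap.ker ((aeval (fun _ : Fin n => (0:K))).toLinearMap :
    MvPolynomial (Fin n) K →ₗ[K] K) ↔ constantCoeff q = 0 := by
    simp [LinearMap.mem_ker, aeval_zero']
  rw [← this, St_ker_const, Submodule.restrictScalars_mem]

theorem St_aeval_mem (θ : Fin n → MvPolynomial (Fin n) K) (k : ℕ) (Q : MvPolynomial (Fin n) K)
    (hQ : Q ∈ StI X k) : aeval θ Q ∈ StI θ k := by
  have : StI (X : Fin n → MvPolynomial (Fin n) K) k ≤ (StI θ k).comap (aeval θ).toRingHom := by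
    refine Ideal.span_le.mpr ?_
    rintro _ ⟨i, hi, rfl⟩
    change aeval θ (X i) ∈ StI θ k
    rw [aeval_X]
    exact Ideal.subset_span ⟨i, hi, rfl⟩
  exact this hQ

theorem St_mk_aeval (θ : Fin n → MvPolynomial (Fin n) K) (Q : MvPolynomial (Fin n) K) :
    Ideal.Quotient.mk (Ideal.span (Set.range θ)) (aeval θ Q) =
      Ideal.Quotient.mk (Ideal.span (Set.range θ)) (C (constantCoeff Q)) := by
  rw [Ideal.Quotient.mk_eq_mk_iff_sub_mem, ← StI_n]
  have := St_aeval_mem θ n (Q - C (constantCoeff Q)) ((St_mem_IXn _).mpr (by simp))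
  rwa [map_sub, aeval_C] at this

theorem St_A_exists (θ : Fin n → MvPolynomial (Fin n) K) (a : Algebra.adjoin K (Set.range θ)) :
    ∃ Q : MvPolynomial (Fin n) K, aeval θ Q = (a : MvPolynomial (Fin n) K) := by
  have h : ∀ p ∈ Algebra.adjoin K (Set.range θ), ∃ Q : MvPolynomial (Fin n) K, aeval θ Q = p := by
    intro p hp
    rw [Algebra.adjoin_range_eq_range_aeval] at hp
    exact hp
  exact h a a.2

theorem St_fd (θ : Fin n → MvPolynomial (Fin n) K)
    (hfin : Module.Finite (Algebra.adjoin K (Set.range θ)) (MvPolynomial (Fin n) K)) :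
    FiniteDimensional K (MvPolynomial (Fin n) K ⧸ Ideal.span (Set.range θ)) := by
  obtain ⟨s, hs⟩ := Module.Finite.fg_top (R := Algebra.adjoin K (Set.range θ))
    (M := MvPolynomial (Fin n) K)
  let f : MvPolynomial (Fin n) K →ₗ[K] (MvPolynomial (Fin n) K ⧸ Ideal.span (Set.range θ)) :=
    (Ideal.Quotient.mkₐ K _).toLinearMap
  classical
  refine ⟨⟨s.image f, ?_⟩⟩
  rw [eq_top_iff]
  rintro v -
  obtain ⟨p, rfl⟩ := Ideal.Quotient.mk_surjective v
  have hp : p ∈ Submodule.span (Algebra.adjoin K (Set.range θ)) (s : Set (MvPolynomial (Fin n) K)) := by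
    rw [hs]; trivial
  change f p ∈ _
  induction hp using Submodule.span_induction with
  | mem x hx => exact Submodule.subset_span (by simpa using ⟨x, hx, rfl⟩)
  | zero => rw [map_zero]; exact zero_mem _
  | add x y _ _ hx hy => rw [map_add]; exact add_mem hx hy
  | smul a x _ hx =>
    obtain ⟨Q, hQ⟩ := St_A_exists θ a
    have : f (a • x) = constantCoeff Q • f x := by
      rw [← map_smul]
      change Ideal.Quotient.mk _ (a.1 * x) = Ideal.Quotient.mk _ _
      rw [map_mul, ← hQ, St_mk_aeval, ← map_mul, C_mul']
    rw [this]
    exact Submodule.smul_mem _ _ hx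

theorem St_rad (θ : Fin n → MvPolynomial (Fin n) K) (d : Fin n → ℕ)
    (hhom : ∀ i, (θ i).IsHomogeneous (d i))
    [FiniteDimensional K (MvPolynomial (Fin n) K ⧸ Ideal.span (Set.range θ))] (i : Fin n) :
    X i ∈ (Ideal.span (Set.range θ)).radical := by
  have hint : IsIntegral K (Ideal.Quotient.mk (Ideal.span (Set.range θ)) (X i)) :=
    Algebra.IsIntegral.isIntegral _
  obtain ⟨f, hf, h⟩ := hint
  have h2 : Polynomial.aeval (X i : MvPolynomial (Fin n) K) f ∈ Ideal.span (Set.range θ) := by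
    rw [← Ideal.Quotient.eq_zero_iff_mem, ← h, ← Polynomial.aeval_def]
    exact (Polynomial.aeval_algHom_apply (Ideal.Quotient.mkₐ K (Ideal.span (Set.range θ))) _ _).symm
  have h3 := StHom_span (Set.range θ) (by rintro _ ⟨i, rfl⟩; exact ⟨_, hhom i⟩) _ h2 f.natDegree
  refine ⟨f.natDegree, ?_⟩
  convert h3
  rw [Polynomial.aeval_eq_sum_range, map_sum, Finset.sum_eq_single f.natDegree]
  · rw [map_smul, hf.coeff_natDegree, one_smul]
    exact (homogeneousComponent_of_mem ((isHomogeneous_X K i).pow f.natDegree |> fun h => by simpa using h)).symm ▸ by simp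
  · intro j _ hj
    rw [map_smul, homogeneousComponent_of_mem (n := j), if_neg hj.symm, smul_zero]
    simpa using (isHomogeneous_X K i).pow j
  · simp

theorem St_indep (θ : Fin n → MvPolynomial (Fin n) K)
    (hreg : ∀ (k : Fin n) p, θ k * p ∈ StI θ k.val → p ∈ StI θ k.val)
    {ι : Type*} [Fintype ι] (b : ι → MvPolynomial (Fin n) K)
    (hb : LinearIndependent K (fun j => Ideal.Quotient.mk (Ideal.span (Set.range θ)) (b j)))
    (P : ι → MvPolynomial (Fin n) K) (hP : ∑ j, aeval θ (P j) * b j = 0) (j : ι) : P j = 0 := by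
  have key : ∀ k ≤ n, ∀ P : ι → MvPolynomial (Fin n) K, ∑ j, aeval θ (P j) * b j ∈ StI θ k →
      ∀ j, P j ∈ StI X k := by
    intro k hk
    induction hk using Nat.decreasingInduction with
    | self =>
      intro P hP j
      rw [St_mem_IXn]
      rw [StI_n, ← Ideal.Quotient.eq_zero_iff_mem, map_sum] at hP
      refine Fintype.linearIndependent_iff.mp hb (fun j => constantCoeff (P j)) ?_ j
      rw [← hP]
      refine Finset.sum_congr rfl fun j _ => ?_
      rw [map_mul, St_mk_aeval, ← map_mul, C_mul']
      rfl
    | of_succ k hk ih =>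
      have main : ∀ N, ∀ P : ι → MvPolynomial (Fin n) K, (∀ j, (P j).totalDegree ≤ N) →
          ∑ j, aeval θ (P j) * b j ∈ StI θ k → ∀ j, P j ∈ StI X k := by
        intro N
        induction N with
        | zero =>
          intro P hN hP j
          have h1 := ih P (by rw [StI_succ θ ⟨k, hk⟩]; exact Ideal.mem_sup_left hP) j
          obtain ⟨i, q, hi, -, e, hq, -⟩ := St_decomp X (fun _ => 1) (fun i => isHomogeneous_X K i)
            ⟨k, hk⟩ 0 (P j) (hN j) h1
          rw [e, hq (by simp), mul_zero, add_zero]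
          exact hi
        | succ N ihN =>
          intro P hN hP
          have h1 := ih P (by rw [StI_succ θ ⟨k, hk⟩]; exact Ideal.mem_sup_left hP)
          have h2 := fun j => St_decomp X (fun _ => 1) (fun i => isHomogeneous_X K i)
            ⟨k, hk⟩ (N + 1) (P j) (hN j) (h1 j)
          choose Q R hQ _ e _ hR using h2
          have h3 : ∑ j, aeval θ (R j) * b j ∈ StI θ k := by
            refine hreg ⟨k, hk⟩ _ ?_
            have : θ ⟨k, hk⟩ * ∑ j, aeval θ (R j) * b j =
                ∑ j, aeval θ (P j) * b j - ∑ j, aeval θ (Q j) * b j := by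
              rw [← Finset.sum_sub_distrib, Finset.mul_sum]
              refine Finset.sum_congr rfl fun j _ => ?_
              rw [e j, map_add, map_mul, aeval_X]; ring
            rw [this]
            exact sub_mem hP (sum_mem fun j _ => Ideal.mul_mem_right _ _ (St_aeval_mem θ k _ (hQ j)))
          have h4 := ihN R (fun j => by simpa using hR j) h3
          intro j
          rw [e j]
          exact add_mem (hQ j) (Ideal.mul_mem_left _ _ (h4 j))
      intro P hP j
      exact main (Finset.univ.sup fun j => (P j).totalDegree) P
        (fun j => Finset.le_sup (f := fun j => (P j).totalDegree) (Finset.mem_univ j)) hP j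
  have := key 0 (Nat.zero_le _) P (by rw [hP]; exact zero_mem _) j
  rwa [StI_zero] at this

theorem St_indepA (θ : Fin n → MvPolynomial (Fin n) K)
    (hreg : ∀ (k : Fin n) p, θ k * p ∈ StI θ k.val → p ∈ StI θ k.val)
    {ι : Type*} [Fintype ι] (b : ι → MvPolynomial (Fin n) K)
    (hb : LinearIndependent K (fun j => Ideal.Quotient.mk (Ideal.span (Set.range θ)) (b j))) :
    LinearIndependent (Algebra.adjoin K (Set.range θ)) b := by
  rw [Fintype.linearIndependent_iff]
  intro c hc j
  choose P hP using fun j => St_A_exists θ (c j)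
  have := St_indep θ hreg b hb P (by
    rw [← hc]
    exact Finset.sum_congr rfl fun j _ => by rw [hP]; rfl) j
  ext1
  rw [← hP, this, map_zero]; rfl

theorem St_I_ne (θ : Fin n → MvPolynomial (Fin n) K) (d : Fin n → ℕ)
    (hhom : ∀ i, (θ i).IsHomogeneous (d i)) (hpos : ∀ i, 0 < d i) :
    (1 : MvPolynomial (Fin n) K) ∉ Ideal.span (Set.range θ) := by
  intro h
  have : Ideal.span (Set.range θ) ≤ RingHom.ker (constantCoeff : MvPolynomial (Fin n) K →+* K) := by
    refine Ideal.span_le.mpr ?_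
    rintro _ ⟨i, rfl⟩
    change constantCoeff (θ i) = 0
    rw [constantCoeff_eq]
    refine (hhom i).coeff_eq_zero ?_
    simpa using (hpos i).ne
  simpa [RingHom.mem_ker] using this h

theorem St_span (θ : Fin n → MvPolynomial (Fin n) K) (d : Fin n → ℕ)
    (hhom : ∀ i, (θ i).IsHomogeneous (d i)) (hpos : ∀ i, 0 < d i)
    (hfin : Module.Finite (Algebra.adjoin K (Set.range θ)) (MvPolynomial (Fin n) K))
    {ι : Type*} [Fintype ι] (b : ι → MvPolynomial (Fin n) K)
    (hb : ⊤ ≤ Submodule.span K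
      (Set.range (fun j => Ideal.Quotient.mk (Ideal.span (Set.range θ)) (b j)))) :
    ∃ a : Algebra.adjoin K (Set.range θ), a ≠ 0 ∧
      ∀ p : MvPolynomial (Fin n) K,
        a • p ∈ Submodule.span (Algebra.adjoin K (Set.range θ)) (Set.range b) := by
  let m : Ideal (Algebra.adjoin K (Set.range θ)) :=
    (Ideal.span (Set.range θ)).comap (algebraMap _ (MvPolynomial (Fin n) K))
  obtain ⟨r, hr, hr2⟩ := Submodule.exists_sub_one_mem_and_smul_le_of_fg_of_le_sup (I := m)
    (N := Submodule.span (Algebra.adjoin K (Set.range θ)) (Set.range b)) (N' := ⊤) (P := ⊤)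
    hfin.fg_top le_rfl (by
      rintro p -
      have := hb (x := Ideal.Quotient.mk (Ideal.span (Set.range θ)) p) trivial
      rw [Submodule.mem_span_range_iff_exists_fun] at this
      obtain ⟨c, hc⟩ := this
      have h1 : p - ∑ j, c j • b j ∈ Ideal.span (Set.range θ) := by
        rw [← Ideal.Quotient.mk_eq_mk_iff_sub_mem, ← hc, map_sum]
        rfl
      rw [← sub_add_cancel p (∑ j, c j • b j), add_comm]
      refine Submodule.add_mem_sup (sum_mem fun j _ => ?_) ?_
      · rw [← IsScalarTower.algebraMap_smul (Algebra.adjoin K (Set.range θ)) (c j) (b j)]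
        exact Submodule.smul_mem _ _ (Submodule.subset_span ⟨j, rfl⟩)
      · generalize p - ∑ j, c j • b j = q at h1
        rw [Ideal.mem_span_range_iff_exists_fun] at h1
        obtain ⟨w, rfl⟩ := h1
        refine sum_mem fun i _ => ?_
        have : w i * θ i = (⟨θ i, Algebra.subset_adjoin ⟨i, rfl⟩⟩ : Algebra.adjoin K (Set.range θ)) • w i := by
          rw [mul_comm]; rfl
        rw [this]
        refine Submodule.smul_mem_smul ?_ trivial
        exact Ideal.subset_span ⟨i, rfl⟩)
  refine ⟨r, ?_, fun p => hr2 (Submodule.smul_mem_pointwise_smul _ _ _ trivial)⟩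
  rintro rfl
  rw [zero_sub, neg_mem_iff] at hr
  exact St_I_ne θ d hhom hpos (by simpa [m] using hr)

end

section

theorem St_nb {L E G : Type*} [Field L] [Field E] [Algebra L E] [FiniteDimensional L E]
    [Group G] [Finite G] (φ : G →* (E ≃ₐ[L] E)) (hφ : Function.Injective φ) :
    ∃ (t : ℕ) (f : Fin t → E) (C : Module.Basis (Fin t × G) L E), ∀ i g, C (i, g) = φ g (f i) := by
  let F := IntermediateField.fixedField φ.range
  have hF : IsGalois F E := IsGalois.of_fixed_field E φ.range
  have hfix : F.fixingSubgroup = φ.range := IntermediateField.fixingSubgroup_fixedField _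
  let eG : G ≃ (E ≃ₐ[F] E) :=
    ((MonoidHom.ofInjective hφ).trans (MulEquiv.subgroupCongr hfix.symm)).toEquiv.trans
      (IntermediateField.fixingSubgroupEquiv F).toEquiv
  have heG : ∀ g x, eG g x = φ g x := fun g x => rfl
  let nb := IsGalois.normalBasis F E
  let u := Module.finBasis L F
  refine ⟨_, fun i => (u i : E) * nb 1, u.smulTower (nb.reindex eG.symm), ?_⟩
  intro i g
  rw [Module.Basis.smulTower_apply, Module.Basis.reindex_apply, Equiv.symm_symm,
    IsGalois.normalBasis_apply, heG, map_mul, Algebra.smul_def]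
  congr 1
  rw [← heG]
  exact ((eG g).commutes (u i)).symm

theorem St_ams {A S E : Type*} [CommRing A] [CommRing S] [Algebra A S] [CommRing E] [Algebra S E]
    [Algebra A E] [IsScalarTower A S E] (a : A) (p : S) :
    algebraMap S E (a • p) = a • algebraMap S E p :=
  (IsScalarTower.toAlgHom A S E).toLinearMap.map_smul a p

theorem St_basisE {A S L E ι : Type*} [CommRing A] [IsDomain A] [CommRing S] [IsDomain S] [Algebra A S]
    [Field L] [Field E] [Algebra A L] [Algebra S E] [IsFractionRing A L] [IsFractionRing S E]
    [Algebra A E] [IsScalarTower A S E] [Algebra L E] [IsScalarTower A L E] [Fintype ι]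
    (b : ι → S) (hb : LinearIndependent A b)
    (hs : ∃ a : A, a ≠ 0 ∧ ∀ p : S, a • p ∈ Submodule.span A (Set.range b)) :
    ∃ B : Module.Basis ι L E, ∀ j, B j = algebraMap S E (b j) := by
  obtain ⟨a, ha, hs⟩ := hs
  have hli : LinearIndependent L (fun j => algebraMap S E (b j)) := by
    rw [← LinearIndependent.iff_fractionRing A L]
    refine hb.map' (IsScalarTower.toAlgHom A S E).toLinearMap (LinearMap.ker_eq_bot.mpr ?_)
    exact IsFractionRing.injective S E
  let T := Submodule.span L (Set.range fun j => algebraMap S E (b j))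
  have hT0 : ∀ p ∈ Submodule.span A (Set.range b), algebraMap S E p ∈ T := by
    intro p hp
    induction hp using Submodule.span_induction with
    | mem x hx => obtain ⟨j, rfl⟩ := hx; exact Submodule.subset_span ⟨j, rfl⟩
    | zero => rw [map_zero]; exact zero_mem _
    | add x y _ _ hx hy => rw [map_add]; exact add_mem hx hy
    | smul c x _ hx =>
      rw [St_ams, ← IsScalarTower.algebraMap_smul L c]
      exact Submodule.smul_mem _ _ hx
  have ha' : algebraMap A L a ≠ 0 := by
    simpa using ha
  have hT : ∀ p, algebraMap S E p ∈ T := by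
    intro p
    have := hT0 _ (hs p)
    rw [St_ams, ← IsScalarTower.algebraMap_smul L a] at this
    exact (Submodule.smul_mem_iff _ ha').mp this
  have hmul : ∀ s : S, ∀ x ∈ T, algebraMap S E s * x ∈ T := by
    intro s x hx
    induction hx using Submodule.span_induction with
    | mem x hx => obtain ⟨j, rfl⟩ := hx; rw [← map_mul]; exact hT _
    | zero => rw [mul_zero]; exact zero_mem _
    | add x y _ _ hx hy => rw [mul_add]; exact add_mem hx hy
    | smul c x _ hx => rw [mul_smul_comm]; exact Submodule.smul_mem _ _ hx
  have : FiniteDimensional L T := FiniteDimensional.span_of_finite _ (Set.finite_range _)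
  have htop : ⊤ ≤ T := by
    rintro x -
    obtain ⟨s, s', hs', rfl⟩ := IsFractionRing.div_surjective S x
    have hs0 : algebraMap S E s' ≠ 0 := by
      simpa using nonZeroDivisors.ne_zero hs'
    let m : T →ₗ[L] T := (LinearMap.mulLeft L (algebraMap S E s')).restrict (fun x hx => hmul s' x hx)
    have hm : Function.Injective m := by
      intro x y h
      have := congrArg Subtype.val h
      ext1
      exact mul_left_cancel₀ hs0 this
    obtain ⟨y, hy⟩ := LinearMap.injective_iff_surjective.mp hm ⟨_, hT s⟩
    have h2 : algebraMap S E s' * y.1 = algebraMap S E s := congrArg Subtype.val hy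
    rw [← h2, mul_div_cancel_left₀ _ hs0]
    exact y.2
  exact ⟨Module.Basis.mk hli htop, fun j => by simp⟩

end

section

theorem St_abs {K A S L E V G ι : Type*} [Field K] [CommRing A] [IsDomain A] [CommRing S] [IsDomain S]
    [Algebra A S] [Algebra K A] [Algebra K S] [IsScalarTower K A S]
    [Field L] [Field E] [Algebra A L] [Algebra S E] [IsFractionRing A L] [IsFractionRing S E]
    [Algebra A E] [IsScalarTower A S E] [Algebra L E] [IsScalarTower A L E] [Fintype ι]
    [AddCommGroup V] [Module K V] [Group G] [Finite G]
    (ψ : G →* (S ≃ₐ[A] S)) (hψ : Function.Injective ψ)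
    (ρ : G → (V →ₗ[K] V)) (σ : V →ₗ[K] S) (hσ : ∀ g v, σ (ρ g v) = ψ g (σ v))
    (v : Module.Basis ι K V) (hb : LinearIndependent A fun j => σ (v j))
    (hs : ∃ a : A, a ≠ 0 ∧ ∀ p : S, a • p ∈ Submodule.span A (Set.range fun j => σ (v j)))
    (hε : ∀ a : A, a ≠ 0 → ∃ ε : A →ₐ[K] K, ε a ≠ 0) :
    ∃ (t : ℕ) (Y : Module.Basis (Fin t × G) K V) (y : Fin t → V), ∀ i g, Y (i, g) = ρ g (y i) := by
  classical
  obtain ⟨B, hB⟩ := St_basisE (L := L) (E := E) _ hb hs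
  have : FiniteDimensional L E := B.finiteDimensional_of_finite
  obtain ⟨t, f, C, hC⟩ := St_nb ((IsFractionRing.fieldEquivOfAlgEquivHom L E).comp ψ)
    ((IsFractionRing.fieldEquivOfAlgEquivHom_injective A S L E).comp hψ)
  obtain ⟨a0, ha0⟩ := IsLocalization.exist_integer_multiples_of_finite (nonZeroDivisors A)
    (fun x : Fin t × ι => B.repr (f x.1) x.2)
  choose c hc using ha0
  have ha0' : algebraMap A L a0 ≠ 0 := by
    simp
  let e : Fin t × G ≃ ι := C.indexEquiv B
  let M : Matrix ι ι A := Matrix.of fun r k => ∑ j, c ((e.symm r).1, j) *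
    algebraMap K A (v.repr (ρ (e.symm r).2 (v j)) k)
  have key1 : ∀ r, ∑ k, algebraMap A L (M r k) • B k = algebraMap A L a0 • C (e.symm r) := by
    intro r
    obtain ⟨⟨i, g⟩, rfl⟩ := e.surjective r
    have h1 : algebraMap A L a0 • f i = ∑ j, algebraMap A L (c (i, j)) • B j := by
      conv_lhs => rw [← B.sum_repr (f i), Finset.smul_sum]
      refine Finset.sum_congr rfl fun j _ => ?_
      rw [hc, smul_smul, Algebra.smul_def (a0 : A)]
    have h2 : ∀ j, IsFractionRing.fieldEquivOfAlgEquivHom L E (ψ g) (B j) =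
        ∑ k, algebraMap A L (algebraMap K A (v.repr (ρ g (v j)) k)) • B k := by
      intro j
      rw [hB, IsFractionRing.fieldEquivOfAlgEquivHom_apply,
        IsFractionRing.fieldEquivOfAlgEquiv_algebraMap, ← hσ]
      conv_lhs => rw [← v.sum_repr (ρ g (v j)), map_sum, map_sum]
      refine Finset.sum_congr rfl fun k _ => ?_
      rw [map_smul, ← IsScalarTower.algebraMap_smul A, St_ams, hB,
        IsScalarTower.algebraMap_smul L (_ : A)]
    rw [Equiv.symm_apply_apply, hC, ← map_smul, h1, map_sum]
    simp only [map_smul, MonoidHom.comp_apply, h2, Finset.smul_sum]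
    rw [Finset.sum_comm]
    refine Finset.sum_congr rfl fun k _ => ?_
    simp only [M, Matrix.of_apply, Equiv.symm_apply_apply, map_sum, map_mul, Finset.sum_smul, smul_smul]
  have hdet : M.det ≠ 0 := by
    intro h0
    have h1 : IsUnit ((algebraMap A L).mapMatrix M) := by
      rw [← Matrix.linearIndependent_rows_iff_isUnit]
      refine LinearIndependent.of_comp B.equivFun.symm.toLinearMap ?_
      have h2 := (C.linearIndependent.comp e.symm e.symm.injective).units_smul
        (fun _ => Units.mk0 _ ha0')
      convert h2 using 1
      ext r
      simp only [Function.comp_apply, LinearEquiv.coe_coe, Module.Basis.equivFun_symm_apply]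
      exact key1 r
    rw [Matrix.isUnit_iff_isUnit_det, ← RingHom.map_det, h0, map_zero] at h1
    exact not_isUnit_zero h1
  obtain ⟨ε, hε⟩ := hε _ hdet
  have h1 : IsUnit (ε.toRingHom.mapMatrix M) := by
    rw [Matrix.isUnit_iff_isUnit_det, ← RingHom.map_det]
    exact isUnit_iff_ne_zero.mpr hε
  rw [← Matrix.linearIndependent_rows_iff_isUnit] at h1
  have h2 := (h1.map' v.equivFun.symm.toLinearMap (LinearEquiv.ker _)).comp e e.injective
  let y : Fin t → V := fun i => ∑ j, ε (c (i, j)) • v j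
  have h3 : (v.equivFun.symm.toLinearMap ∘ (ε.toRingHom.mapMatrix M).row) ∘ e =
      fun x => ρ x.2 (y x.1) := by
    ext ⟨i, g⟩
    have h4 : ∀ j, ρ g (v j) = ∑ k, v.repr (ρ g (v j)) k • v k := fun j => (v.sum_repr _).symm
    simp only [Function.comp_apply, LinearEquiv.coe_coe, Module.Basis.equivFun_symm_apply, y, map_sum,
      map_smul]
    conv_rhs => enter [2, j]; rw [h4, Finset.smul_sum]
    rw [Finset.sum_comm]
    refine Finset.sum_congr rfl fun k _ => ?_
    simp [M, Matrix.row, map_sum, Finset.sum_smul, smul_smul]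
  rw [h3] at h2
  have : Fintype G := Fintype.ofFinite G
  have : FiniteDimensional K V := v.finiteDimensional_of_finite
  have hcard : Fintype.card (Fin t × G) = Module.finrank K V := by
    rw [Module.finrank_eq_card_basis v]
    exact Fintype.card_congr e
  refine ⟨t, Module.Basis.mk h2 (h2.span_eq_top_of_card_eq_finrank' hcard).ge, y, fun i g => ?_⟩
  rw [Module.Basis.mk_apply]

theorem St_final {K V G : Type*} [Field K] [AddCommGroup V] [Module K V] [Group G] [Finite G]
    (ρ : G → (V →ₗ[K] V)) (hρ : ∀ g h v, ρ (g * h) v = ρ g (ρ h v))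
    (t : ℕ) (Y : Module.Basis (Fin t × G) K V) (y : Fin t → V) (hY : ∀ i g, Y (i, g) = ρ g (y i))
    (m : ℕ) (hm : Module.finrank K V = m) :
    ∃ e : V ≃ₗ[K] (Fin (m / Nat.card G) → MonoidAlgebra K G),
      ∀ (g : G) (v : V) i, e (ρ g v) i = MonoidAlgebra.of K G g * e v i := by
  classical
  have : Fintype G := Fintype.ofFinite G
  subst hm
  have ht : Module.finrank K V / Nat.card G = t := by
    rw [Module.finrank_eq_card_basis Y, Fintype.card_prod, Fintype.card_fin, Nat.card_eq_fintype_card]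
    exact Nat.mul_div_cancel _ Fintype.card_pos
  rw [ht]
  let Z : Module.Basis (Fin t × G) K (Fin t → MonoidAlgebra K G) :=
    (Pi.basis fun _ : Fin t => MonoidAlgebra.basis G K).reindex (Equiv.sigmaEquivProd _ _)
  have hZ : ∀ i g, Z (i, g) = Pi.single i (MonoidAlgebra.single g 1) := by
    intro i g
    simp [Z, Equiv.sigmaEquivProd, Pi.basis_apply]
  let e := Y.equiv Z (Equiv.refl _)
  have he : ∀ i g, e (ρ g (y i)) = Pi.single i (MonoidAlgebra.single g 1) := by
    intro i g
    rw [← hY, Module.Basis.equiv_apply, Equiv.refl_apply, hZ]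
  refine ⟨e, fun g v i => ?_⟩
  let l : (Fin t → MonoidAlgebra K G) →ₗ[K] (Fin t → MonoidAlgebra K G) :=
    LinearMap.pi fun i => (LinearMap.mulLeft K (MonoidAlgebra.of K G g)).comp (LinearMap.proj i)
  have h : e.toLinearMap.comp (ρ g) = l.comp e.toLinearMap := by
    refine Y.ext ?_
    rintro ⟨j, h⟩
    rw [hY]
    simp only [LinearMap.comp_apply, LinearEquiv.coe_coe]
    rw [← hρ, he, he]
    ext1 i
    change _ = MonoidAlgebra.of K G g * _
    by_cases hij : i = j
    · subst hij; simp [MonoidAlgebra.single_mul_single]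
    · simp [Pi.single_eq_of_ne hij]
  exact congrFun (LinearMap.congr_fun h v) i

end

section
variable {K : Type*} [Field K] {n : ℕ}

theorem St_act_X (g : Matrix.GeneralLinearGroup (Fin n) K) (i : Fin n) :
    matrixAct g (X i) = ∑ j, ((g⁻¹ : Matrix.GeneralLinearGroup (Fin n) K) :
      Matrix (Fin n) (Fin n) K) i j • X j := by
  rw [matrixAct, aeval_X]

theorem St_act_one : matrixAct (1 : Matrix.GeneralLinearGroup (Fin n) K) = AlgHom.id K _ := by
  refine MvPolynomial.algHom_ext fun i => ?_
  rw [St_act_X]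
  simp [Matrix.one_apply]

theorem St_act_mul (g h : Matrix.GeneralLinearGroup (Fin n) K) :
    matrixAct (g * h) = (matrixAct g).comp (matrixAct h) := by
  refine MvPolynomial.algHom_ext fun i => ?_
  rw [AlgHom.comp_apply, St_act_X, St_act_X, map_sum]
  simp only [map_smul, St_act_X, Finset.smul_sum, smul_smul]
  rw [Finset.sum_comm]
  refine Finset.sum_congr rfl fun k _ => ?_
  rw [← Finset.sum_smul, mul_inv_rev, Units.val_mul, Matrix.mul_apply]

theorem St_act_inj (g h : Matrix.GeneralLinearGroup (Fin n) K)
    (hgh : ∀ p, matrixAct g p = matrixAct h p) : g = h := by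
  rw [← inv_inj]
  ext i j
  have := congrArg (coeff (Finsupp.single j 1)) (hgh (X i))
  rw [St_act_X, St_act_X, coeff_sum, coeff_sum] at this
  simpa [coeff_X, Finsupp.single_left_inj] using this

end

set_option maxHeartbeats 1000000 in
/-- **Stanley's theorem.** If `θ₁, …, θₙ` is a homogeneous system of parameters of positive
degrees `d₁, …, dₙ` consisting of `G`-invariants, for a finite subgroup `G` of `GLₙ(K)` in
characteristic zero, then the quotient `K[x]/(θ₁,…,θₙ)` is isomorphic, as a module over the
group algebra `K[G]` (i.e. via a `K`-linear, `G`-equivariant isomorphism), to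
`t = (d₁⋯dₙ)/|G|` copies of the regular representation of `G`. -/
theorem stanley_quotient_isom_regular_reps {K : Type*} [Field K] [CharZero K] {n : ℕ}
    (hn : 0 < n) (G : Subgroup (Matrix.GeneralLinearGroup (Fin n) K)) [Finite G]
    (θ : Fin n → MvPolynomial (Fin n) K) (d : Fin n → ℕ)
    (hhom : ∀ i, (θ i).IsHomogeneous (d i)) (hpos : ∀ i, 0 < d i)
    (hinv : ∀ g ∈ G, ∀ i, matrixAct g (θ i) = θ i)
    (halg : AlgebraicIndependent K θ)
    (hfin : Module.Finite (Algebra.adjoin K (Set.range θ)) (MvPolynomial (Fin n) K)) :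
    ∃ e : (MvPolynomial (Fin n) K ⧸ Ideal.span (Set.range θ)) ≃ₗ[K]
        (Fin ((∏ i, d i) / Nat.card G) → MonoidAlgebra K ↥G),
      ∀ (g : ↥G) (p : MvPolynomial (Fin n) K) (i : Fin ((∏ i, d i) / Nat.card G)),
        e (Ideal.Quotient.mk (Ideal.span (Set.range θ))
            (matrixAct (g : Matrix.GeneralLinearGroup (Fin n) K) p)) i =
          MonoidAlgebra.of K ↥G g * e (Ideal.Quotient.mk (Ideal.span (Set.range θ)) p) i := by
  have hfd := St_fd θ hfin
  have hrad := St_rad θ d hhom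
  have hreg : ∀ (k : Fin n) p, θ k * p ∈ StI θ k.val → p ∈ StI θ k.val :=
    fun k p h => St_theta_reg θ d hhom hpos hrad k p h
  have hfr := St_finrank_quot θ d hhom (fun i => halg.ne_zero i) hreg
  have hfix : ∀ g : G, ∀ a ∈ Algebra.adjoin K (Set.range θ),
      matrixAct (g : Matrix.GeneralLinearGroup (Fin n) K) a = a := by
    intro g a ha
    induction ha using Algebra.adjoin_induction with
    | mem x hx => obtain ⟨i, rfl⟩ := hx; exact hinv g g.2 i
    | algebraMap r => exact AlgHom.commutes _ r
    | add x y _ _ hx hy => rw [map_add, hx, hy]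
    | mul x y _ _ hx hy => rw [map_mul, hx, hy]
  let φ : G →* (MvPolynomial (Fin n) K →ₐ[Algebra.adjoin K (Set.range θ)] MvPolynomial (Fin n) K) :=
    { toFun := fun g =>
        { (matrixAct (g : Matrix.GeneralLinearGroup (Fin n) K)).toRingHom with
          commutes' := fun a => hfix g a a.2 }
      map_one' := by
        ext1 p
        exact AlgHom.congr_fun St_act_one p
      map_mul' := fun g h => by
        ext1 p
        exact AlgHom.congr_fun (St_act_mul (g : Matrix.GeneralLinearGroup (Fin n) K) h) p }
  let ψ : G →* (MvPolynomial (Fin n) K ≃ₐ[Algebra.adjoin K (Set.range θ)] MvPolynomial (Fin n) K) :=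
    (AlgEquiv.algHomUnitsEquiv _ _).toMonoidHom.comp φ.toHomUnits
  have hψ' : ∀ (g : G) p, ψ g p = matrixAct (g : Matrix.GeneralLinearGroup (Fin n) K) p :=
    fun g p => rfl
  have hψ : Function.Injective ψ := by
    intro g h hgh
    ext1
    refine St_act_inj _ _ fun p => ?_
    rw [← hψ', ← hψ', hgh]
  have hI : ∀ g : G, Ideal.span (Set.range θ) ≤
      (Ideal.span (Set.range θ)).comap (matrixAct (g : Matrix.GeneralLinearGroup (Fin n) K)) := by
    intro g
    refine Ideal.span_le.mpr ?_
    rintro _ ⟨i, rfl⟩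
    change matrixAct (g : Matrix.GeneralLinearGroup (Fin n) K) (θ i) ∈ Ideal.span (Set.range θ)
    rw [hinv g g.2 i]
    exact Ideal.subset_span ⟨i, rfl⟩
  let ρ : G → ((MvPolynomial (Fin n) K ⧸ Ideal.span (Set.range θ)) →ₗ[K]
      (MvPolynomial (Fin n) K ⧸ Ideal.span (Set.range θ))) := fun g =>
    (Ideal.quotientMapₐ (Ideal.span (Set.range θ))
      (matrixAct (g : Matrix.GeneralLinearGroup (Fin n) K)) (hI g)).toLinearMap
  have hρ' : ∀ (g : G) p, ρ g (Ideal.Quotient.mk _ p) =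
      Ideal.Quotient.mk _ (matrixAct (g : Matrix.GeneralLinearGroup (Fin n) K) p) := fun g p => rfl
  have hρ : ∀ g h v, ρ (g * h) v = ρ g (ρ h v) := by
    intro g h v
    obtain ⟨p, rfl⟩ := Ideal.Quotient.mk_surjective v
    rw [hρ', hρ', hρ', Subgroup.coe_mul, St_act_mul, AlgHom.comp_apply]
  have hρ1 : ∀ v, ρ 1 v = v := by
    intro v
    obtain ⟨p, rfl⟩ := Ideal.Quotient.mk_surjective v
    rw [hρ', Subgroup.coe_one, St_act_one, AlgHom.id_apply]
  let π : MvPolynomial (Fin n) K →ₗ[K] (MvPolynomial (Fin n) K ⧸ Ideal.span (Set.range θ)) :=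
    (Ideal.Quotient.mkₐ K _).toLinearMap
  obtain ⟨s, hs⟩ := LinearMap.exists_rightInverse_of_surjective π
    (LinearMap.range_eq_top.mpr Ideal.Quotient.mk_surjective)
  have hs' : ∀ v, π (s v) = v := fun v => LinearMap.congr_fun hs v
  have : Fintype G := Fintype.ofFinite G
  let σ : (MvPolynomial (Fin n) K ⧸ Ideal.span (Set.range θ)) →ₗ[K] MvPolynomial (Fin n) K :=
    (Fintype.card G : K)⁻¹ • ∑ g : G,
      ((matrixAct (g : Matrix.GeneralLinearGroup (Fin n) K)).toLinearMap.comp s).comp (ρ g⁻¹)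
  have hσv : ∀ v, σ v = (Fintype.card G : K)⁻¹ • ∑ g : G,
      matrixAct (g : Matrix.GeneralLinearGroup (Fin n) K) (s (ρ g⁻¹ v)) := by
    intro v
    simp [σ, LinearMap.sum_apply]
  have hπσ : ∀ v, π (σ v) = v := by
    intro v
    rw [hσv, map_smul, map_sum]
    have : ∀ g : G, π (matrixAct (g : Matrix.GeneralLinearGroup (Fin n) K) (s (ρ g⁻¹ v))) = v := by
      intro g
      change ρ g (π (s (ρ g⁻¹ v))) = v
      rw [hs', ← hρ, mul_inv_cancel, hρ1]
    simp only [this, Finset.sum_const, Finset.card_univ]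
    rw [← Nat.cast_smul_eq_nsmul K, smul_smul, inv_mul_cancel₀ (by simp), one_smul]
  have hσ : ∀ g v, σ (ρ g v) = ψ g (σ v) := by
    intro g v
    rw [hψ', hσv, hσv, map_smul, map_sum]
    congr 1
    refine (Fintype.sum_equiv (Equiv.mulLeft g) _ _ fun h => ?_).symm
    have hg : (g * h)⁻¹ * g = h⁻¹ := by group
    rw [Equiv.coe_mulLeft, ← hρ, hg, Subgroup.coe_mul, St_act_mul, AlgHom.comp_apply]
  let v := Module.finBasis K (MvPolynomial (Fin n) K ⧸ Ideal.span (Set.range θ))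
  have hvσ : (fun j => Ideal.Quotient.mk (Ideal.span (Set.range θ)) (σ (v j))) = v :=
    funext fun j => hπσ (v j)
  have hli := St_indepA θ hreg (fun j => σ (v j)) (by rw [hvσ]; exact v.linearIndependent)
  have hsp := St_span θ d hhom hpos hfin (fun j => σ (v j)) (by rw [hvσ, v.span_eq])
  have hε : ∀ a : Algebra.adjoin K (Set.range θ), a ≠ 0 →
      ∃ ε : Algebra.adjoin K (Set.range θ) →ₐ[K] K, ε a ≠ 0 := by
    intro a ha
    have h1 : halg.aevalEquiv.symm a ≠ 0 := by simpa using ha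
    have h2 : ∃ x, eval x (halg.aevalEquiv.symm a) ≠ 0 := by
      by_contra hcon
      push Not at hcon
      exact h1 (MvPolynomial.funext fun x => by rw [hcon, map_zero])
    obtain ⟨x, hx⟩ := h2
    exact ⟨(aeval x).comp halg.aevalEquiv.symm.toAlgHom, hx⟩
  let iA : Algebra (FractionRing (Algebra.adjoin K (Set.range θ)))
      (FractionRing (MvPolynomial (Fin n) K)) := FractionRing.liftAlgebra _ _
  have iT := FractionRing.isScalarTower_liftAlgebra (Algebra.adjoin K (Set.range θ))
    (FractionRing (MvPolynomial (Fin n) K))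
  obtain ⟨t, Y, y, hY⟩ := St_abs (L := FractionRing (Algebra.adjoin K (Set.range θ)))
    (E := FractionRing (MvPolynomial (Fin n) K)) ψ hψ ρ σ hσ v hli hsp hε
  obtain ⟨e, he⟩ := St_final ρ hρ t Y y hY _ hfr
  exact ⟨e, fun g p i => he g (Ideal.Quotient.mk _ p) i⟩
end

section
/- Let n be a positive integer and let the symmetric group S_n act on the polynomial ring ℚ[x_1,...,x_n] by permuting the variables. Let e_1,...,e_n denote the elementary symmetric polynomials in x_1,...,x_n. Then the coinvariant ring ℚ[x_1,...,x_n]/(e_1,...,e_n), with its induced S_n-action, is isomorphic as a module over the group algebra ℚ[S_n] to the regular representation of S_n (that is, to ℚ[S_n] acting on itself by left multiplication). -/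
open MvPolynomial

open Pointwise in
theorem span_bound (m : ℕ) : ∀ (S T : Type) [CommRing S] [CommRing T] [Algebra S T] (x : Fin m → T)
    (_ : Algebra.adjoin S (Set.range x) = ⊤) (q : Polynomial S)
    (_ : q.map (algebraMap S T) = ∏ i, (Polynomial.X - Polynomial.C (x i))) (_ : q.Monic)
    (_ : q.natDegree = m),
    ∃ s : Finset T, s.card ≤ m.factorial ∧ Submodule.span S (s : Set T) = ⊤ := by
  classical
  induction m with
  | zero =>
    intro S T _ _ _ x hx q hq _ _
    refine ⟨{1}, by simp, ?_⟩
    have : Set.range x = ∅ := Set.range_eq_empty x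
    rw [this, Algebra.adjoin_empty] at hx
    rw [Finset.coe_singleton, ← Submodule.one_eq_span, ← Algebra.toSubmodule_bot, hx]
    simp
  | succ m ih =>
    intro S T _ _ _ x hx q hq hm hd
    let A := Algebra.adjoin S {x 0}
    let y : A := ⟨x 0, Algebra.subset_adjoin rfl⟩
    let q1 : Polynomial A := (q.map (algebraMap S A)) /ₘ (Polynomial.X - Polynomial.C y)
    have hmX : (Polynomial.X - Polynomial.C y).Monic := Polynomial.monic_X_sub_C y
    have hmap : q1.map (algebraMap A T) = ∏ i : Fin m, (Polynomial.X - Polynomial.C (x i.succ)) := by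
      rw [Polynomial.map_divByMonic _ hmX, Polynomial.map_map, ← IsScalarTower.algebraMap_eq, hq,
        Fin.prod_univ_succ]
      have : (Polynomial.X - Polynomial.C y).map (algebraMap A T)
        = Polynomial.X - Polynomial.C (x 0) := by
        simp [y]
      rw [this, Polynomial.mul_divByMonic_cancel_left _ (Polynomial.monic_X_sub_C _)]
    have hinj : Function.Injective (algebraMap A T) := Subtype.val_injective
    have hmon : q1.Monic := by
      apply Polynomial.monic_of_injective hinj
      rw [hmap]
      exact Polynomial.monic_prod_of_monic _ _ fun i _ => Polynomial.monic_X_sub_C _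
    by_cases hT : Nontrivial T
    swap
    · rw [not_nontrivial_iff_subsingleton] at hT
      exact ⟨∅, by simp, Subsingleton.elim _ _⟩
    have hdeg : q1.natDegree = m := by
      rw [← Polynomial.natDegree_map_eq_of_injective hinj, hmap,
        Polynomial.natDegree_prod_of_monic _ _ fun i _ => Polynomial.monic_X_sub_C _]
      simp
    have hgen : Algebra.adjoin A (Set.range fun i : Fin m => x i.succ) = ⊤ := by
      have h0 : x 0 ∈ Algebra.adjoin A (Set.range fun i : Fin m => x i.succ) := by
        have := Subalgebra.algebraMap_mem (Algebra.adjoin A (Set.range fun i : Fin m => x i.succ)) y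
        rwa [Subalgebra.algebraMap_def] at this
      have h2 : ∀ j : Fin m, x j.succ ∈ Algebra.adjoin A (Set.range fun i : Fin m => x i.succ) :=
        fun j => Algebra.subset_adjoin ⟨j, rfl⟩
      generalize Algebra.adjoin A (Set.range fun i : Fin m => x i.succ) = D at h0 h2
      have h1 : Algebra.adjoin S (Set.range x) ≤ D.restrictScalars S := by
        apply Algebra.adjoin_le
        rintro _ ⟨i, rfl⟩
        refine Fin.cases ?_ (fun j => ?_) i
        · exact h0
        · exact h2 j
      rw [hx] at h1
      rw [eq_top_iff]
      intro z _
      exact h1 (Algebra.mem_top (x := z))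
    obtain ⟨t, ht, hts⟩ := ih A T (fun i => x i.succ) hgen q1 hmap hmon hdeg
    have hroot : Polynomial.aeval y q = 0 := by
      apply hinj
      rw [← Polynomial.aeval_algebraMap_apply, map_zero, ← Polynomial.eval_map_algebraMap, hq,
        Polynomial.eval_prod]
      exact Finset.prod_eq_zero (Finset.mem_univ 0) (by simp [y])
    have hs : Submodule.span S ((Finset.image (y ^ ·) (Finset.range q.natDegree) : Finset A) : Set A)
        = ⊤ := by
      have h0 := Submodule.span_range_natDegree_eq_adjoin hm hroot
      have : Algebra.adjoin S {y} = ⊤ := by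
        have := Algebra.adjoin_adjoin_coe_preimage (R := S) (s := {x 0})
        convert this using 2
        ext z
        simp [y, Subtype.ext_iff]
      rw [this] at h0
      rw [Algebra.top_toSubmodule] at h0
      convert h0
      rfl
    refine ⟨(Finset.image (y ^ ·) (Finset.range q.natDegree) : Finset A) • t, ?_, ?_⟩
    · refine Finset.card_smul_le.trans ?_
      rw [Nat.factorial_succ]
      refine Nat.mul_le_mul ?_ ht
      exact Finset.card_image_le.trans (by simp [hd])
    · rw [Finset.coe_smul, Submodule.span_smul_of_span_eq_top hs, hts]
      simp

theorem orth_exists {M : Type} [AddCommGroup M] [Module ℚ M] (B : M →ₗ[ℚ] M →ₗ[ℚ] ℚ)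
    (hB : ∀ f, B f f = 0 → f = 0) (W : Submodule ℚ M) [FiniteDimensional ℚ W] (f : M) :
    ∃ w ∈ W, ∀ g ∈ W, B (f - w) g = 0 := by
  let φ : W →ₗ[ℚ] Module.Dual ℚ W := (LinearMap.lcomp ℚ ℚ W.subtype) ∘ₗ B ∘ₗ W.subtype
  have hinj : Function.Injective φ := by
    rw [← LinearMap.ker_eq_bot, LinearMap.ker_eq_bot']
    intro w hw
    have : B w w = 0 := LinearMap.congr_fun hw w
    exact Subtype.ext (hB _ this)
  have hsurj : Function.Surjective φ :=
    (LinearMap.injective_iff_surjective_of_finrank_eq_finrank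
      (Subspace.dual_finrank_eq).symm).1 hinj
  obtain ⟨w, hw⟩ := hsurj (B f ∘ₗ W.subtype)
  refine ⟨w, w.2, fun g hg => ?_⟩
  have : B w g = B f g := LinearMap.congr_fun hw ⟨g, hg⟩
  rw [map_sub, LinearMap.sub_apply, this, sub_self]

noncomputable def BB (n : ℕ) : MvPolynomial (Fin n) ℚ →ₗ[ℚ] MvPolynomial (Fin n) ℚ →ₗ[ℚ] ℚ :=
  (basisMonomials (Fin n) ℚ).constr ℚ (fun a => lcoeff ℚ a)

theorem BB_monomial (n : ℕ) (a : Fin n →₀ ℕ) (c : ℚ) (g : MvPolynomial (Fin n) ℚ) :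
    BB n (monomial a c) g = c * coeff a g := by
  have h : monomial a c = c • (basisMonomials (Fin n) ℚ a) := by
    simp [coe_basisMonomials, smul_monomial]
  rw [h, map_smul, BB, Module.Basis.constr_basis]
  simp

theorem BB_apply (n : ℕ) (f g : MvPolynomial (Fin n) ℚ) :
    BB n f g = ∑ a ∈ f.support, coeff a f * coeff a g := by
  conv_lhs => rw [f.as_sum]
  rw [map_sum, LinearMap.sum_apply]
  exact Finset.sum_congr rfl fun a _ => BB_monomial n a _ g

theorem BB_pos (n : ℕ) (f : MvPolynomial (Fin n) ℚ) (h : BB n f f = 0) : f = 0 := by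
  rw [BB_apply, Finset.sum_eq_zero_iff_of_nonneg (fun _ _ => mul_self_nonneg _)] at h
  ext a
  by_cases ha : a ∈ f.support
  · simpa using h a ha
  · simpa using ha

theorem BB_rename (n : ℕ) (σ : Equiv.Perm (Fin n)) (f g : MvPolynomial (Fin n) ℚ) :
    BB n (rename σ f) (rename σ g) = BB n f g := by
  induction f using MvPolynomial.induction_on' with
  | monomial a c =>
    rw [rename_monomial, BB_monomial, BB_monomial, coeff_rename_mapDomain _ σ.injective]
  | add p q hp hq => simp only [map_add, LinearMap.add_apply, hp, hq]

theorem BB_hom (n : ℕ) {d d' : ℕ} (h : d ≠ d') (f g : MvPolynomial (Fin n) ℚ)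
    (hf : f.IsHomogeneous d) (hg : g.IsHomogeneous d') : BB n f g = 0 := by
  rw [BB_apply]
  refine Finset.sum_eq_zero fun a _ => ?_
  by_cases ha : a.degree = d
  · rw [hg.coeff_eq_zero (by omega), mul_zero]
  · rw [hf.coeff_eq_zero ha, zero_mul]

noncomputable abbrev II (n : ℕ) : Ideal (MvPolynomial (Fin n) ℚ) :=
  Ideal.span (Set.range fun k : Fin n => esymm (Fin n) ℚ ((k : ℕ) + 1))

theorem esymm_hom (n k : ℕ) : (esymm (Fin n) ℚ k).IsHomogeneous k := by
  rw [esymm_eq_sum_monomial]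
  refine IsHomogeneous.sum _ _ _ fun t ht => isHomogeneous_monomial _ ?_
  rw [map_sum]
  simp [(Finset.mem_powersetCard.1 ht).2]

theorem II_rename (n : ℕ) (σ : Equiv.Perm (Fin n)) (f : MvPolynomial (Fin n) ℚ)
    (hf : f ∈ II n) : rename σ f ∈ II n := by
  have : II n ≤ (II n).comap (rename σ : MvPolynomial (Fin n) ℚ →ₐ[ℚ] _) := by
    refine Ideal.span_le.2 ?_
    rintro _ ⟨k, rfl⟩
    simp only [SetLike.mem_coe, Ideal.mem_comap, rename_esymm]
    exact Ideal.subset_span ⟨k, rfl⟩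
  exact this hf

/-- the space orthogonal to the ideal -/
noncomputable def VV (n : ℕ) : Submodule ℚ (MvPolynomial (Fin n) ℚ) where
  carrier := {f | ∀ g ∈ II n, BB n f g = 0}
  zero_mem' := by simp
  add_mem' := by
    intro a b ha hb g hg
    simp [ha g hg, hb g hg]
  smul_mem' := by
    intro c a ha g hg
    simp [ha g hg]

theorem VV_rename (n : ℕ) (σ : Equiv.Perm (Fin n)) (f : MvPolynomial (Fin n) ℚ)
    (hf : f ∈ VV n) : rename σ f ∈ VV n := by
  intro g hg
  have := hf _ (II_rename n σ⁻¹ g hg)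
  rw [← BB_rename n σ, rename_rename] at this
  rw [← Equiv.Perm.coe_mul, mul_inv_cancel, Equiv.Perm.coe_one, rename_id_apply] at this
  exact this

theorem II_ind (n : ℕ) (P : Submodule ℚ (MvPolynomial (Fin n) ℚ))
    (h : ∀ (k : Fin n) (a : Fin n →₀ ℕ), esymm (Fin n) ℚ (k + 1) * monomial a 1 ∈ P)
    (f : MvPolynomial (Fin n) ℚ) (hf : f ∈ II n) : f ∈ P := by
  have h' : ∀ (k : Fin n) (g : MvPolynomial (Fin n) ℚ), g * esymm (Fin n) ℚ (k + 1) ∈ P := by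
    intro k g
    induction g using MvPolynomial.induction_on' with
    | monomial a c =>
      have := P.smul_mem c (h k a)
      rwa [← mul_smul_comm, smul_monomial, smul_eq_mul, mul_one, mul_comm] at this
    | add p q hp hq => rw [add_mul]; exact P.add_mem hp hq
  obtain ⟨c, rfl⟩ := Ideal.mem_span_range_iff_exists_fun.1 hf
  exact P.sum_mem fun k _ => h' k _

def JS (n d : ℕ) : Set (MvPolynomial (Fin n) ℚ) :=
  (fun p : Fin n × (Fin n →₀ ℕ) => esymm (Fin n) ℚ (p.1 + 1) * monomial p.2 1) ''
    {p | p.2.degree + (p.1 + 1) = d}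

theorem JS_finite (n d : ℕ) : (JS n d).Finite := by
  refine Set.Finite.image _ ?_
  refine ((Set.finite_univ (α := Fin n)).prod (Finsupp.finite_of_degree_le (σ := Fin n) d)).subset ?_
  rintro ⟨k, a⟩ h
  simp only [Set.mem_ofPred_eq] at h
  simp
  omega

theorem JS_hom (n d : ℕ) (f) (hf : f ∈ Submodule.span ℚ (JS n d)) : f.IsHomogeneous d := by
  have : Submodule.span ℚ (JS n d) ≤ homogeneousSubmodule (Fin n) ℚ d := by
    refine Submodule.span_le.2 ?_
    rintro _ ⟨⟨k, a⟩, h, rfl⟩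
    simp only [Set.mem_ofPred_eq] at h
    have := (esymm_hom n (k+1)).mul (isHomogeneous_monomial (σ := Fin n) (1:ℚ) (d := a) rfl)
    simp only [SetLike.mem_coe, mem_homogeneousSubmodule]
    convert this using 1
    omega
  exact this hf

theorem JS_le (n d : ℕ) (f) (hf : f ∈ Submodule.span ℚ (JS n d)) : f ∈ II n := by
  have : Submodule.span ℚ (JS n d) ≤ (II n).restrictScalars ℚ := by
    refine Submodule.span_le.2 ?_
    rintro _ ⟨⟨k, a⟩, h, rfl⟩
    exact Ideal.mul_mem_right _ _ (Ideal.subset_span ⟨k, rfl⟩)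
  exact this hf

theorem decomp (n d : ℕ) (f : MvPolynomial (Fin n) ℚ) (hf : f.IsHomogeneous d) :
    ∃ w ∈ Submodule.span ℚ (JS n d), f - w ∈ VV n := by
  have := FiniteDimensional.span_of_finite ℚ (JS_finite n d)
  obtain ⟨w, hw, h⟩ := orth_exists (BB n) (BB_pos n) (Submodule.span ℚ (JS n d)) f
  refine ⟨w, hw, fun g hg => ?_⟩
  refine II_ind n (LinearMap.ker (BB n (f - w))) (fun k a => ?_) g hg
  rw [LinearMap.mem_ker]
  by_cases hd : a.degree + (k + 1) = d
  · exact h _ (Submodule.subset_span ⟨(k, a), hd, rfl⟩)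
  · refine BB_hom n (d := d) (d' := (k + 1) + a.degree) (by omega) _ _ (hf.sub (JS_hom n d w hw)) ?_
    exact (esymm_hom n (k+1)).mul (isHomogeneous_monomial (σ := Fin n) (1:ℚ) (d := a) rfl)

theorem hom_ind (n : ℕ) (P : Submodule ℚ (MvPolynomial (Fin n) ℚ))
    (h : ∀ d f, f.IsHomogeneous d → f ∈ P) (f) : f ∈ P := by
  rw [← sum_homogeneousComponent f]
  exact P.sum_mem fun i _ => h i _ (homogeneousComponent_isHomogeneous i f)

theorem decomp_all (n : ℕ) (f : MvPolynomial (Fin n) ℚ) : ∃ v ∈ VV n, ∃ i ∈ II n, v + i = f := by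
  have : f ∈ VV n ⊔ (II n).restrictScalars ℚ := by
    refine hom_ind n _ (fun d f hf => ?_) f
    obtain ⟨w, hw, h⟩ := decomp n d f hf
    exact Submodule.mem_sup.2 ⟨f - w, h, w, JS_le n d w hw, by simp⟩
  exact Submodule.mem_sup.1 this

noncomputable def pt (n : ℕ) (τ : Equiv.Perm (Fin n)) : Fin n → ℚ := fun i => ((τ⁻¹ i : Fin n) : ℕ)

noncomputable def FF (n : ℕ) : MvPolynomial (Fin n) ℚ →ₗ[ℚ] (Equiv.Perm (Fin n) → ℚ) :=
  LinearMap.pi fun τ => (aeval (pt n τ)).toLinearMap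

theorem FF_apply (n : ℕ) (f) (τ) : FF n f τ = aeval (pt n τ) f := rfl

theorem FF_esymm (n k : ℕ) (g : MvPolynomial (Fin n) ℚ) :
    FF n (esymm (Fin n) ℚ k * g) = (aeval (pt n 1) (esymm (Fin n) ℚ k) : ℚ) • FF n g := by
  ext τ
  simp only [FF_apply, map_mul, Pi.smul_apply, smul_eq_mul]
  congr 1
  conv_rhs => rw [← rename_esymm (Fin n) ℚ k τ⁻¹, aeval_rename]
  rfl

theorem FF_VV (n : ℕ) (f : MvPolynomial (Fin n) ℚ) : FF n f ∈ (VV n).map (FF n) := by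
  suffices h : ∀ d, ∀ f : MvPolynomial (Fin n) ℚ, f.IsHomogeneous d → FF n f ∈ (VV n).map (FF n) from
    hom_ind n (((VV n).map (FF n)).comap (FF n)) h f
  intro d
  induction d using Nat.strong_induction_on with
  | _ d ih =>
    intro f hf
    obtain ⟨w, hw, h⟩ := decomp n d f hf
    have hw' : Submodule.span ℚ (JS n d) ≤ ((VV n).map (FF n)).comap (FF n) := by
      refine Submodule.span_le.2 ?_
      rintro _ ⟨⟨k, a⟩, h, rfl⟩
      simp only [Set.mem_ofPred_eq] at h
      simp only [SetLike.mem_coe, Submodule.mem_comap]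
      rw [FF_esymm]
      exact Submodule.smul_mem _ _ (ih a.degree (by omega) _ (isHomogeneous_monomial _ rfl))
    have := Submodule.add_mem _ (Submodule.mem_map_of_mem (f := FF n) h) (hw' hw)
    rwa [← map_add, sub_add_cancel] at this

theorem pt_inj (n : ℕ) : Function.Injective (pt n) := by
  intro σ τ h
  rw [← inv_inj]
  ext i
  have := congrFun h i
  simpa [pt] using this

theorem FF_surj (n : ℕ) : Function.Surjective (FF n) := by
  classical
  rw [← LinearMap.range_eq_top, eq_top_iff, ← (Pi.basisFun ℚ (Equiv.Perm (Fin n))).span_eq,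
    Submodule.span_le]
  rintro _ ⟨σ, rfl⟩
  have hsep : ∀ τ : Equiv.Perm (Fin n), τ ≠ σ → ∃ p : MvPolynomial (Fin n) ℚ,
      aeval (pt n τ) p = (0:ℚ) ∧ aeval (pt n σ) p = (1:ℚ) := by
    intro τ hτ
    have : pt n τ ≠ pt n σ := fun h => hτ (pt_inj n h)
    obtain ⟨i, hi⟩ := Function.ne_iff.1 this
    have hi' : pt n σ i - pt n τ i ≠ 0 := sub_ne_zero.2 hi.symm
    refine ⟨C (pt n σ i - pt n τ i)⁻¹ * (X i - C (pt n τ i)), ?_, ?_⟩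
    · simp
    · simp [hi']
  choose! p hp using hsep
  refine ⟨∏ τ ∈ Finset.univ.erase σ, p τ, ?_⟩
  ext τ
  rw [FF_apply, map_prod, Pi.basisFun_apply]
  by_cases h : τ = σ
  · subst h
    rw [Pi.single_eq_same]
    exact Finset.prod_eq_one fun ρ hρ => (hp ρ (Finset.ne_of_mem_erase hρ)).2
  · rw [Pi.single_eq_of_ne h]
    exact Finset.prod_eq_zero (Finset.mem_erase.2 ⟨h, Finset.mem_univ _⟩) (hp τ h).1

theorem finrank_bound (n : ℕ) : Module.Finite ℚ (MvPolynomial (Fin n) ℚ ⧸ II n) ∧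
    Module.finrank ℚ (MvPolynomial (Fin n) ℚ ⧸ II n) ≤ n.factorial := by
  obtain ⟨s, hs, hs'⟩ := span_bound n ℚ (MvPolynomial (Fin n) ℚ ⧸ II n)
    (fun i => -Ideal.Quotient.mk (II n) (X i)) (by
      rw [eq_top_iff]
      intro z _
      obtain ⟨p, rfl⟩ := Ideal.Quotient.mk_surjective z
      induction p using MvPolynomial.induction_on with
      | C a => exact Subalgebra.algebraMap_mem _ a
      | add p q hp hq => rw [map_add]; exact add_mem (hp trivial) (hq trivial)
      | mul_X p i hp =>
        rw [map_mul]
        refine mul_mem (hp trivial) ?_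
        rw [← neg_neg (Ideal.Quotient.mk (II n) (X i))]
        exact neg_mem (Algebra.subset_adjoin ⟨i, rfl⟩)) (Polynomial.X ^ n) (by
      have h := congrArg (Polynomial.map (Ideal.Quotient.mk (II n)))
        (MvPolynomial.prod_C_add_X_eq_sum_esymm ℚ (Fin n))
      rw [Polynomial.map_prod, Polynomial.map_sum, Finset.sum_range_succ', Finset.sum_eq_zero] at h
      · simpa using h.symm
      · intro i hi
        have : Ideal.Quotient.mk (II n) (esymm (Fin n) ℚ (i + 1)) = 0 :=
          Ideal.Quotient.eq_zero_iff_mem.2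
            (Ideal.subset_span ⟨⟨i, by simpa using hi⟩, rfl⟩)
        simp [this]) (Polynomial.monic_X_pow n) (Polynomial.natDegree_X_pow n)
  refine ⟨⟨⟨s, hs'⟩⟩, ?_⟩
  rw [← finrank_top ℚ (MvPolynomial (Fin n) ℚ ⧸ II n), ← hs']
  exact (finrank_span_finset_le_card s).trans hs

noncomputable def GG (n : ℕ) : (Equiv.Perm (Fin n) → ℚ) ≃ₗ[ℚ] MonoidAlgebra ℚ (Equiv.Perm (Fin n)) :=
  (Finsupp.linearEquivFunOnFinite ℚ ℚ _).symm ≪≫ₗ (MonoidAlgebra.coeffLinearEquiv ℚ).symm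

theorem GG_FF (n : ℕ) (σ : Equiv.Perm (Fin n)) (f : MvPolynomial (Fin n) ℚ) :
    GG n (FF n (rename σ f)) = MonoidAlgebra.of ℚ (Equiv.Perm (Fin n)) σ * GG n (FF n f) := by
  have key : ∀ (h : Equiv.Perm (Fin n) → ℚ) τ, (GG n h).coeff τ = h τ := fun h τ => rfl
  ext τ
  rw [key, MonoidAlgebra.of_apply, MonoidAlgebra.coeff_single_mul_eq_mul_coeff (σ⁻¹ * τ) (by intro m _; rw [eq_inv_mul_iff_mul_eq]), key, one_mul, FF_apply, FF_apply,
    aeval_rename]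
  congr 2

theorem coinvariant_ring_isom_regular_rep (n : ℕ) (hn : 0 < n) :
    ∃ e : (MvPolynomial (Fin n) ℚ ⧸
        Ideal.span (Set.range fun k : Fin n => esymm (Fin n) ℚ ((k : ℕ) + 1))) ≃ₗ[ℚ]
        MonoidAlgebra ℚ (Equiv.Perm (Fin n)),
      ∀ (σ : Equiv.Perm (Fin n)) (p : MvPolynomial (Fin n) ℚ),
        e (Ideal.Quotient.mk (Ideal.span (Set.range fun k : Fin n => esymm (Fin n) ℚ ((k : ℕ) + 1)))
            (rename (⇑σ) p)) =
          MonoidAlgebra.of ℚ (Equiv.Perm (Fin n)) σ *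
            e (Ideal.Quotient.mk
                (Ideal.span (Set.range fun k : Fin n => esymm (Fin n) ℚ ((k : ℕ) + 1))) p) := by
  obtain ⟨hfin, hrank⟩ := finrank_bound n
  let π : VV n →ₗ[ℚ] (MvPolynomial (Fin n) ℚ ⧸ II n) :=
    (Ideal.Quotient.mkₐ ℚ (II n)).toLinearMap ∘ₗ (VV n).subtype
  have hπ : ∀ v : VV n, π v = Ideal.Quotient.mk (II n) v := fun v => rfl
  have hπi : Function.Injective π := by
    rw [← LinearMap.ker_eq_bot, LinearMap.ker_eq_bot']
    intro v hv
    rw [hπ, Ideal.Quotient.eq_zero_iff_mem] at hv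
    exact Subtype.ext (BB_pos n _ (v.2 _ hv))
  have hmk : ∀ v ∈ VV n, ∀ i ∈ II n, Ideal.Quotient.mk (II n) (v + i) = Ideal.Quotient.mk (II n) v := by
    intro v _ i hi
    rw [map_add, Ideal.Quotient.eq_zero_iff_mem.2 hi, add_zero]
  have hπs : Function.Surjective π := by
    intro z
    obtain ⟨p, rfl⟩ := Ideal.Quotient.mk_surjective z
    obtain ⟨v, hv, i, hi, rfl⟩ := decomp_all n p
    exact ⟨⟨v, hv⟩, by rw [hπ, hmk v hv i hi]⟩
  let E := LinearEquiv.ofBijective π ⟨hπi, hπs⟩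
  let ψ : VV n →ₗ[ℚ] (Equiv.Perm (Fin n) → ℚ) := FF n ∘ₗ (VV n).subtype
  have hψs : Function.Surjective ψ := by
    intro y
    obtain ⟨f, rfl⟩ := FF_surj n y
    obtain ⟨v, hv, h⟩ := FF_VV n f
    exact ⟨⟨v, hv⟩, h⟩
  have : Module.Finite ℚ (VV n) := Module.Finite.equiv E.symm
  have hrk : Module.finrank ℚ (VV n) = Module.finrank ℚ (Equiv.Perm (Fin n) → ℚ) := by
    apply le_antisymm
    · rw [E.finrank_eq, Module.finrank_fintype_fun_eq_card, Fintype.card_perm, Fintype.card_fin]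
      exact hrank
    · exact LinearMap.finrank_le_finrank_of_surjective hψs
  have hψi : Function.Injective ψ :=
    (LinearMap.injective_iff_surjective_of_finrank_eq_finrank hrk).2 hψs
  let E2 := LinearEquiv.ofBijective ψ ⟨hψi, hψs⟩
  have hE : ∀ v (hv : v ∈ VV n) i (_ : i ∈ II n),
      (E.symm ≪≫ₗ E2 ≪≫ₗ GG n) (Ideal.Quotient.mk (II n) (v + i)) = GG n (FF n v) := by
    intro v hv i hi
    have : E.symm (Ideal.Quotient.mk (II n) (v + i)) = ⟨v, hv⟩ := by
      rw [LinearEquiv.symm_apply_eq, hmk v hv i hi]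
      rfl
    rw [LinearEquiv.trans_apply, LinearEquiv.trans_apply, this]
    rfl
  refine ⟨E.symm ≪≫ₗ E2 ≪≫ₗ GG n, fun σ p => ?_⟩
  obtain ⟨v, hv, i, hi, rfl⟩ := decomp_all n p
  have h1 := hE v hv i hi
  have h2 := hE _ (VV_rename n σ v hv) _ (II_rename n σ i hi)
  rw [← map_add] at h2
  exact h2.trans ((GG_FF n σ v).trans (congrArg _ h1.symm))
end

section
/- Let n be a positive integer and let e_1,...,e_n be the elementary symmetric polynomials in x_1,...,x_n over ℚ. Then the quotient ring ℚ[x_1,...,x_n]/(e_1,...,e_n) is a ℚ-vector space of dimension n!. -/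
open MvPolynomial Nat

theorem splitting_aux (n : ℕ) : ∀ (R : Type) [CommRing R] [Nontrivial R] (f : Polynomial R),
    f.Monic → f.natDegree = n →
    ∃ (S : Type) (_ : CommRing S) (_ : Algebra R S) (a : Fin n → S),
      Module.Free R S ∧ Module.Finite R S ∧ Module.finrank R S = n ! ∧
      f.map (algebraMap R S) = ∏ i, (Polynomial.X - Polynomial.C (a i)) ∧
      (∀ (T : Type) [CommRing T] (h : R →+* T) (b : Fin n → T),
        f.map h = ∏ i, (Polynomial.X - Polynomial.C (b i)) →
        ∃ ph : S →+* T, ph.comp (algebraMap R S) = h ∧ ∀ i, ph (a i) = b i) ∧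
      (∀ (T : Type) [CommRing T] (ph qs : S →+* T),
        ph.comp (algebraMap R S) = qs.comp (algebraMap R S) → (∀ i, ph (a i) = qs (a i)) →
        ph = qs) := by
  induction n with
  | zero =>
    intro R _ _ f hf hd
    have h1 : f = 1 := Polynomial.eq_one_of_monic_natDegree_zero hf hd
    subst h1
    refine ⟨R, inferInstance, Algebra.id R, Fin.elim0, inferInstance, inferInstance, ?_, ?_, ?_, ?_⟩
    · simp
    · simp
    · intro T _ h b _
      exact ⟨h, by ext; simp, fun i => i.elim0⟩
    · intro T _ ph qs h _
      ext x
      exact RingHom.congr_fun h x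
  | succ n ih =>
    intro R _ _ f hf hd
    haveI : Nontrivial (AdjoinRoot f) := by
      have hdim : (AdjoinRoot.powerBasis' hf).dim = n + 1 := by
        rw [AdjoinRoot.powerBasis'_dim, hd]
      exact ⟨_, _, (AdjoinRoot.powerBasis' hf).basis.ne_zero ⟨0, by omega⟩⟩
    have hroot : (f.map (AdjoinRoot.of f)).IsRoot (AdjoinRoot.root f) := by
      rw [Polynomial.IsRoot.def, Polynomial.eval_map, AdjoinRoot.eval₂_root]
    obtain ⟨g, hg⟩ := Polynomial.dvd_iff_isRoot.2 hroot
    have hgm : g.Monic := (Polynomial.monic_X_sub_C _).of_mul_monic_left (hg ▸ hf.map _)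
    have hgd : g.natDegree = n := by
      have := congrArg Polynomial.natDegree hg
      rw [(Polynomial.monic_X_sub_C _).natDegree_mul hgm, hf.natDegree_map, hd,
        Polynomial.natDegree_X_sub_C] at this
      omega
    obtain ⟨S, _, _, a, hfree, hfin, hrank, hsplit, hex, huniq⟩ := ih (AdjoinRoot f) g hgm hgd
    letI algRS : Algebra R S := ((algebraMap (AdjoinRoot f) S).comp (AdjoinRoot.of f)).toAlgebra
    have hmap : algebraMap R S = (algebraMap (AdjoinRoot f) S).comp (AdjoinRoot.of f) := rfl
    haveI : IsScalarTower R (AdjoinRoot f) S := IsScalarTower.of_algebraMap_eq' hmap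
    let pb := AdjoinRoot.powerBasis' hf
    haveI : Module.Free R (AdjoinRoot f) := Module.Free.of_basis pb.basis
    haveI : Module.Finite R (AdjoinRoot f) := Module.Finite.of_basis pb.basis
    refine ⟨S, inferInstance, algRS, Fin.cons (algebraMap _ S (AdjoinRoot.root f)) a,
      Module.Free.trans (R := R) (S := AdjoinRoot f), Module.Finite.trans (AdjoinRoot f) S, ?_, ?_, ?_, ?_⟩
    · rw [← Module.finrank_mul_finrank R (AdjoinRoot f) S, hrank, pb.finrank,
        AdjoinRoot.powerBasis'_dim, hd, Nat.factorial_succ]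
    · rw [hmap, ← Polynomial.map_map, hg, Polynomial.map_mul, hsplit, Fin.prod_univ_succ]
      simp
    · intro T _ h b hb
      have hb0 : f.eval₂ h (b 0) = 0 := by
        rw [← Polynomial.eval_map, hb, Fin.prod_univ_succ]
        simp
      let h1 : AdjoinRoot f →+* T := AdjoinRoot.lift h (b 0) hb0
      have h1c : h1.comp (AdjoinRoot.of f) = h := AdjoinRoot.lift_comp_of hb0
      have h1r : h1 (AdjoinRoot.root f) = b 0 := AdjoinRoot.lift_root hb0
      have hgT : g.map h1 = ∏ i : Fin n, (Polynomial.X - Polynomial.C (b i.succ)) := by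
        apply (Polynomial.monic_X_sub_C (b 0)).isRegular.left
        have := congrArg (Polynomial.map h1) hg
        rw [Polynomial.map_map, h1c, hb, Fin.prod_univ_succ, Polynomial.map_mul] at this
        simp only [Polynomial.map_sub, Polynomial.map_X, Polynomial.map_C, h1r] at this
        exact this.symm
      obtain ⟨ph, hph, hpha⟩ := hex T h1 _ hgT
      refine ⟨ph, ?_, ?_⟩
      · rw [hmap, ← RingHom.comp_assoc, hph, h1c]
      · intro i
        refine Fin.cases ?_ (fun j => ?_) i
        · have := RingHom.congr_fun hph (AdjoinRoot.root f)
          simpa [h1r] using this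
        · simpa using hpha j
    · intro T _ ph qs h ha
      apply huniq T ph qs
      · apply AdjoinRoot.ringHom_ext
        · rw [RingHom.comp_assoc, RingHom.comp_assoc, ← hmap, h]
        · simpa using ha 0
      · intro i
        simpa using ha i.succ

theorem prod_eq_X_pow_iff {T : Type} [CommRing T] [Algebra ℚ T] (n : ℕ) (a : Fin n → T) :
    ((Polynomial.X : Polynomial T) ^ n = ∏ i, (Polynomial.X - Polynomial.C (a i))) ↔
      ∀ k : Fin n, aeval a (esymm (Fin n) ℚ ((k : ℕ) + 1)) = 0 := by
  have key : ∀ k ≤ n, (∏ i, (Polynomial.X - Polynomial.C (a i))).coeff k =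
      (-1) ^ (n - k) * aeval a (esymm (Fin n) ℚ (n - k)) := by
    intro k hk
    have := Multiset.prod_X_sub_C_coeff (Finset.univ.val.map a) (k := k) (by simpa using hk)
    rw [aeval_esymm_eq_multiset_esymm]
    rw [Multiset.map_map, Multiset.card_map, Finset.card_val, Finset.card_univ,
      Fintype.card_fin] at this
    exact this
  constructor
  · intro h k
    have h2 := key (n - (k + 1)) (by omega)
    rw [← h, Polynomial.coeff_X_pow, if_neg (by omega)] at h2
    have h3 : n - (n - ((k : ℕ) + 1)) = k + 1 := by omega
    rw [h3] at h2
    have h4 : IsUnit ((-1 : T) ^ ((k : ℕ) + 1)) := (isUnit_one.neg).pow _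
    exact (h4.mul_right_eq_zero).1 h2.symm
  · intro h
    ext k
    rw [Polynomial.coeff_X_pow]
    rcases lt_trichotomy k n with hk | hk | hk
    · rw [key k hk.le, if_neg hk.ne]
      have := h ⟨n - k - 1, by omega⟩
      have h3 : n - k - 1 + 1 = n - k := by omega
      simp only [h3] at this
      rw [this, mul_zero]
    · subst hk
      rw [key k le_rfl]
      simp
    · rw [if_neg hk.ne', Polynomial.coeff_eq_zero_of_natDegree_lt]
      refine lt_of_le_of_lt (Polynomial.natDegree_prod_le _ _) ?_
      refine lt_of_le_of_lt (Finset.sum_le_card_nsmul _ _ 1 ?_) (by simpa using hk)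
      intro i _
      exact Polynomial.natDegree_X_sub_C_le _

/-- The coinvariant ring `ℚ[x₁,…,xₙ]/(e₁,…,eₙ)` is a `ℚ`-vector space of dimension `n!`. -/
theorem coinvariant_ring_finrank (n : ℕ) (hn : 0 < n) :
    Module.finrank ℚ (MvPolynomial (Fin n) ℚ ⧸
        Ideal.span (Set.range fun k : Fin n => esymm (Fin n) ℚ ((k : ℕ) + 1))) = n ! := by
  obtain ⟨S, _, _, a, -, -, hrank, hsplit, hex, huniq⟩ :=
    splitting_aux n ℚ (Polynomial.X ^ n) (Polynomial.monic_X_pow n) (Polynomial.natDegree_X_pow n)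
  rw [← hrank]
  set I := Ideal.span (Set.range fun k : Fin n => esymm (Fin n) ℚ ((k : ℕ) + 1)) with hI
  rw [Polynomial.map_pow, Polynomial.map_X, prod_eq_X_pow_iff] at hsplit
  let qs : (MvPolynomial (Fin n) ℚ ⧸ I) →ₐ[ℚ] S := Ideal.Quotient.liftₐ I (aeval a) (by
    intro x hx
    have : I ≤ RingHom.ker (aeval (R := ℚ) a) := by
      rw [hI, Ideal.span_le]
      rintro _ ⟨k, rfl⟩
      exact hsplit k
    exact this hx)
  have hqs : ∀ i, qs (Ideal.Quotient.mk I (X i)) = a i := by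
    intro i
    change aeval a (X i) = a i
    simp
  obtain ⟨ph, hph, hpha⟩ := hex (MvPolynomial (Fin n) ℚ ⧸ I) (algebraMap ℚ _)
    (fun i => Ideal.Quotient.mk I (X i)) (by
      rw [Polynomial.map_pow, Polynomial.map_X, prod_eq_X_pow_iff]
      intro k
      have : (aeval fun i => Ideal.Quotient.mk I (X i : MvPolynomial (Fin n) ℚ)) =
          Ideal.Quotient.mkₐ ℚ I := by
        ext i
        simp
      rw [this]
      exact Ideal.Quotient.eq_zero_iff_mem.2 (Ideal.subset_span ⟨k, rfl⟩))
  let ph' : S →ₐ[ℚ] (MvPolynomial (Fin n) ℚ ⧸ I) :=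
    { ph with commutes' := fun r => RingHom.congr_fun hph r }
  have hph' : ∀ i, ph' (a i) = Ideal.Quotient.mk I (X i) := hpha
  have e1 : qs.comp ph' = AlgHom.id ℚ S := by
    have := huniq S (qs.comp ph').toRingHom (AlgHom.id ℚ S).toRingHom
      (Subsingleton.elim _ _) (fun i => by
        change qs (ph' (a i)) = a i
        rw [hph', hqs])
    ext x
    exact RingHom.congr_fun this x
  have e2 : ph'.comp qs = AlgHom.id ℚ _ := by
    apply Ideal.Quotient.algHom_ext
    ext i
    change ph' (qs (Ideal.Quotient.mk I (X i))) = Ideal.Quotient.mk I (X i)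
    rw [hqs, hph']
  exact (AlgEquiv.ofAlgHom qs ph' e1 e2).toLinearEquiv.finrank_eq
end

section
/- Let n be a positive integer and let G be a subgroup of the symmetric group S_n acting on ℚ[x_1,...,x_n] by permuting the variables. Then the invariant ring ℚ[x_1,...,x_n]^G is a free module of rank n!/|G| over the subalgebra Sym = ℚ[e_1,...,e_n] of symmetric polynomials; that is, there exist polynomials η_1,...,η_{n!/|G|} in ℚ[x_1,...,x_n]^G such that ℚ[x_1,...,x_n]^G = ⊕_{i=1}^{n!/|G|} η_i · ℚ[e_1,...,e_n]. -/
open MvPolynomial Nat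

/-- The subalgebra of `ℚ[x₁,…,xₙ]` of polynomials invariant under a subgroup `G` of `Sₙ`
acting by permutation of the variables. -/
noncomputable def invariantSubalgebra (n : ℕ) (G : Subgroup (Equiv.Perm (Fin n))) :
    Subalgebra ℚ (MvPolynomial (Fin n) ℚ) :=
  ⨅ g ∈ G, AlgHom.equalizer (rename (⇑g) : MvPolynomial (Fin n) ℚ →ₐ[ℚ] MvPolynomial (Fin n) ℚ)
    (AlgHom.id ℚ (MvPolynomial (Fin n) ℚ))

theorem mem_inv {n : ℕ} {G : Subgroup (Equiv.Perm (Fin n))} {p : MvPolynomial (Fin n) ℚ} :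
    p ∈ invariantSubalgebra n G ↔ ∀ g ∈ G, rename (⇑g) p = p := by
  simp [invariantSubalgebra, Algebra.mem_iInf, AlgHom.mem_equalizer]

theorem mem_adj {n : ℕ} {p : MvPolynomial (Fin n) ℚ} :
    p ∈ Algebra.adjoin ℚ (Set.range fun k : Fin n => esymm (Fin n) ℚ ((k : ℕ) + 1)) ↔
      p.IsSymmetric := by
  rw [Algebra.adjoin_range_eq_range_aeval, AlgHom.mem_range]
  constructor
  · rintro ⟨q, rfl⟩
    rw [← esymmAlgHom_apply]
    exact (esymmAlgHom (Fin n) ℚ n q).2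
  · intro h
    obtain ⟨q, hq⟩ := (esymmAlgHom_fin_bijective ℚ n).2 ⟨p, h⟩
    refine ⟨q, ?_⟩
    rw [← esymmAlgHom_apply, hq]

@[reducible] noncomputable def permAct (n : ℕ) :
    MulSemiringAction (Equiv.Perm (Fin n)) (MvPolynomial (Fin n) ℚ) where
  smul g p := rename g p
  one_smul p := rename_id_apply p
  mul_smul g h p := by
    change rename _ p = rename _ (rename _ p)
    rw [rename_rename]; rfl
  smul_zero g := map_zero (rename (R := ℚ) g)
  smul_add g := map_add (rename (R := ℚ) g)
  smul_one g := map_one (rename (R := ℚ) g)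
  smul_mul g := map_mul (rename (R := ℚ) g)

theorem finrank_inv {n : ℕ} (G : Subgroup (Equiv.Perm (Fin n)))
    (A : Subalgebra ℚ (MvPolynomial (Fin n) ℚ))
    (hA : ∀ p, p ∈ A ↔ ∀ g ∈ G, rename (⇑g) p = p) :
    Module.finrank A (MvPolynomial (Fin n) ℚ) = Nat.card G := by
  let := permAct n
  have hs : ∀ (g : G) (p : MvPolynomial (Fin n) ℚ), g • p = rename (⇑(g : Equiv.Perm (Fin n))) p :=
    fun _ _ => rfl
  have : IsGaloisGroup G A (MvPolynomial (Fin n) ℚ) :=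
    { faithful := ⟨by
        intro g h hgh
        ext i : 2
        have := hgh (X i)
        rw [hs, hs, rename_X, rename_X] at this
        exact X_injective this⟩
      commutes := ⟨by
        intro g a p
        rw [hs, hs, Algebra.smul_def, Algebra.smul_def, map_mul]
        congr 1
        exact (hA _).1 a.2 g g.2⟩
      isInvariant := ⟨fun p hp => ⟨⟨p, (hA p).2 fun g hg => hp ⟨g, hg⟩⟩, rfl⟩⟩ }
  exact (IsGaloisGroup.card_eq_finrank' G A (MvPolynomial (Fin n) ℚ)).symm

theorem finrank_sym {n : ℕ} (S : Subalgebra ℚ (MvPolynomial (Fin n) ℚ))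
    (hS : ∀ p, p ∈ S ↔ p.IsSymmetric) :
    Module.finrank S (MvPolynomial (Fin n) ℚ) = n ! := by
  rw [finrank_inv ⊤ S (fun p => by simp [hS, IsSymmetric])]
  simp [Fintype.card_perm]

theorem indep_of_span {S R : Type*} [CommRing S] [IsDomain S] [AddCommGroup R] [Module S R]
    {ι : Type*} [Fintype ι] (b : ι → R) (hb : Submodule.span S (Set.range b) = ⊤)
    (hc : Fintype.card ι ≤ Module.finrank S R) : LinearIndependent S b := by
  have : Module.Finite S R := ⟨(Set.finite_range b).toFinset, by simpa using hb⟩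
  have hs : LinearMap.range (Fintype.linearCombination S b) = ⊤ := by
    rw [Fintype.range_linearCombination, hb]
  have h1 := LinearMap.lift_rank_range_add_rank_ker (Fintype.linearCombination S b)
  rw [hs, rank_top, rank_fun', ← Module.finrank_eq_rank] at h1
  rw [linearIndependent_iff_injective_fintypeLinearCombination, ← LinearMap.ker_eq_bot,
    ← Submodule.rank_eq_zero (R := S)]
  generalize Module.rank S (LinearMap.ker (Fintype.linearCombination S b)) = κ at h1
  simp only [Cardinal.lift_natCast] at h1
  have hlt : Cardinal.lift κ < Cardinal.aleph0 :=
    (self_le_add_left _ _).trans_lt (h1.trans_lt (Cardinal.natCast_lt_aleph0))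
  obtain ⟨m, hm⟩ := Cardinal.lt_aleph0.1 hlt
  rw [hm] at h1
  have h2 : Module.finrank S R + m = Fintype.card ι := by exact_mod_cast h1
  have : m = 0 := by omega
  rw [this] at hm
  simpa using hm

/-- coefficients of the partial product -/
noncomputable def Qk (n k : ℕ) : Polynomial (MvPolynomial (Fin n) ℚ) :=
  ∏ j ∈ Finset.univ.filter (fun j : Fin n => k ≤ j), (Polynomial.X - Polynomial.C (X j))

theorem Qk_succ {n k : ℕ} (h : k < n) :
    Qk n k = (Polynomial.X - Polynomial.C (X ⟨k, h⟩)) * Qk n (k+1) := by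
  unfold Qk
  rw [← Finset.prod_insert (a := (⟨k, h⟩ : Fin n))
    (f := fun j : Fin n => (Polynomial.X - Polynomial.C (X j : MvPolynomial (Fin n) ℚ))) (by simp)]
  congr 1
  ext j
  simp [Fin.ext_iff]
  omega

theorem Qk_monic (n k : ℕ) : (Qk n k).Monic :=
  Polynomial.monic_prod_of_monic _ _ fun _ _ => Polynomial.monic_X_sub_C _

theorem Qk_natDegree {n k : ℕ} (hk : k ≤ n) : (Qk n k).natDegree = n - k := by
  unfold Qk
  rw [Polynomial.natDegree_prod_of_monic _ _ fun _ _ => Polynomial.monic_X_sub_C _]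
  simp only [Polynomial.natDegree_X_sub_C, Finset.sum_const, smul_eq_mul, mul_one]
  have h := Finset.card_filter_add_card_filter_not (s := (Finset.univ : Finset (Fin n)))
    (fun j => (j : ℕ) < k)
  simp only [not_lt, Fin.card_filter_val_lt, Finset.card_univ, Fintype.card_fin] at h
  omega

theorem Qk_zero {n : ℕ} (S : Subalgebra ℚ (MvPolynomial (Fin n) ℚ))
    (hS : ∀ p, p ∈ S ↔ p.IsSymmetric) (i : ℕ) : (Qk n 0).coeff i ∈ S := by
  rw [hS]
  intro e
  have : (Qk n 0).map ((rename e : _ →ₐ[ℚ] MvPolynomial (Fin n) ℚ) : _ →+* MvPolynomial (Fin n) ℚ) = Qk n 0 := by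
    simp only [Qk, Polynomial.map_prod]
    simp
    exact Equiv.prod_comp e (fun j => (Polynomial.X - Polynomial.C (X j : MvPolynomial (Fin n) ℚ)))
  conv_rhs => rw [← this]
  rw [Polynomial.coeff_map]; rfl

theorem coeff_div {R : Type*} [CommRing R] [Algebra ℚ R] (B : Subalgebra ℚ R) {x : R}
    (P Q : Polynomial R) (hx : x ∈ B) (hPQ : P = (Polynomial.X - Polynomial.C x) * Q)
    (hP : ∀ i, P.coeff i ∈ B) (i : ℕ) : Q.coeff i ∈ B := by
  obtain ⟨p, hp⟩ : ∃ p : Polynomial B, p.map (algebraMap B R) = P := by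
    have : P ∈ Polynomial.lifts (algebraMap B R) := by
      rw [Polynomial.lifts_iff_coeff_lifts]
      exact fun i => ⟨⟨_, hP i⟩, rfl⟩
    exact this
  have : (p /ₘ (Polynomial.X - Polynomial.C (⟨x, hx⟩ : B))).map (algebraMap B R) = Q := by
    rw [Polynomial.map_divByMonic _ (Polynomial.monic_X_sub_C _), hp, hPQ]
    simp only [Polynomial.map_sub, Polynomial.map_X, Polynomial.map_C]
    exact Polynomial.mul_divByMonic_cancel_left _ (Polynomial.monic_X_sub_C _)
  rw [← this, Polynomial.coeff_map]
  exact Subtype.property _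

theorem span_step {n : ℕ} (S : Subalgebra ℚ (MvPolynomial (Fin n) ℚ))
    (hS : ∀ p, p ∈ S ↔ p.IsSymmetric) (k : ℕ) (hk : k ≤ n) :
    ∃ A : Subalgebra ℚ (MvPolynomial (Fin n) ℚ), S ≤ A ∧ (∀ j : Fin n, (j : ℕ) < k → X j ∈ A) ∧
      (∀ i, (Qk n k).coeff i ∈ A) ∧
      ∃ T : Finset (MvPolynomial (Fin n) ℚ), T.card ≤ n.descFactorial k ∧
        ∀ a ∈ A, a ∈ Submodule.span S (T : Set (MvPolynomial (Fin n) ℚ)) := by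
  induction k with
  | zero =>
    refine ⟨S, le_rfl, by simp, Qk_zero S hS, {1}, by simp, fun a ha => ?_⟩
    rw [Finset.coe_singleton, Submodule.mem_span_singleton]
    exact ⟨⟨a, ha⟩, by simp [Algebra.smul_def]⟩
  | succ k ih =>
    obtain ⟨A, hSA, hX, hQ, T, hT, hA⟩ := ih (by omega)
    have hkn : k < n := hk
    set x : MvPolynomial (Fin n) ℚ := X ⟨k, hkn⟩ with hx
    obtain ⟨p, hp⟩ : ∃ p : Polynomial A, p.map (algebraMap A _) = Qk n k := by
      have : Qk n k ∈ Polynomial.lifts (algebraMap A (MvPolynomial (Fin n) ℚ)) := by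
        rw [Polynomial.lifts_iff_coeff_lifts]
        exact fun i => ⟨⟨_, hQ i⟩, rfl⟩
      exact this
    have hinj : Function.Injective (algebraMap A (MvPolynomial (Fin n) ℚ)) := Subtype.val_injective
    have hpm : p.Monic := by
      apply Polynomial.monic_of_injective hinj
      rw [hp]; exact Qk_monic n k
    have hpx : Polynomial.aeval x p = 0 := by
      rw [← Polynomial.aeval_map_algebraMap (MvPolynomial (Fin n) ℚ), hp, Qk_succ hkn]
      simp [hx]
    have hdeg : p.natDegree = n - k := by
      rw [← Qk_natDegree hkn.le, ← hp, Polynomial.natDegree_map_eq_of_injective hinj]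
    have hspan := Submodule.span_range_natDegree_eq_adjoin hpm hpx
    have hAle : ∀ a ∈ A, a ∈ Algebra.adjoin A {x} := fun a ha =>
      Subalgebra.algebraMap_mem (Algebra.adjoin A {x}) (⟨a, ha⟩ : A)
    have hxm : x ∈ Algebra.adjoin A {x} := Algebra.subset_adjoin rfl
    refine ⟨(Algebra.adjoin A {x}).restrictScalars ℚ, fun a ha => hAle a (hSA ha), ?_, ?_, 
      Finset.image₂ (fun t j => t * x ^ j) T (Finset.range (n - k)), ?_, ?_⟩
    · intro j hj
      rcases Nat.lt_succ_iff_lt_or_eq.1 hj with h | h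
      · exact hAle _ (hX j h)
      · have : j = ⟨k, hkn⟩ := Fin.ext h
        rw [this]; exact hxm
    · exact coeff_div ((Algebra.adjoin A {x}).restrictScalars ℚ) _ _ hxm (Qk_succ hkn) fun i => hAle _ (hQ i)
    · refine (Finset.card_image₂_le _ _ _).trans ?_
      rw [Finset.card_range, Nat.descFactorial_succ, mul_comm]
      exact Nat.mul_le_mul_left _ hT
    · intro a ha
      have ha' : a ∈ Subalgebra.toSubmodule (Algebra.adjoin A {x}) := ha
      rw [← hspan, hdeg, @Finset.coe_image _ _ (fun a b => Classical.propDecidable (a = b)), Submodule.mem_span_image_finset_iff_exists_fun] at ha'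
      obtain ⟨c, rfl⟩ := ha'
      refine Submodule.sum_mem _ fun j hj => ?_
      have hc := hA (c j) (c j).2
      rw [Algebra.smul_def]
      change ((c j : A) : MvPolynomial (Fin n) ℚ) * x ^ (j : ℕ) ∈ _
      generalize ((c j : A) : MvPolynomial (Fin n) ℚ) = y at hc
      induction hc using Submodule.span_induction with
      | mem y hy =>
        exact Submodule.subset_span (Finset.mem_coe.2 (Finset.mem_image₂_of_mem hy j.2))
      | zero => rw [zero_mul]; exact zero_mem _
      | add y z _ _ hy hz => rw [add_mul]; exact add_mem hy hz
      | smul c y _ hy => rw [smul_mul_assoc]; exact Submodule.smul_mem _ _ hy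

theorem span_all {n : ℕ} (S : Subalgebra ℚ (MvPolynomial (Fin n) ℚ))
    (hS : ∀ p, p ∈ S ↔ p.IsSymmetric) :
    ∃ T : Finset (MvPolynomial (Fin n) ℚ), T.card ≤ n ! ∧
        Submodule.span S (T : Set (MvPolynomial (Fin n) ℚ)) = ⊤ := by
  obtain ⟨A, -, hX, -, T, hT, hA⟩ := span_step S hS n le_rfl
  refine ⟨T, by simpa [Nat.descFactorial_self] using hT, eq_top_iff.2 fun p _ => hA p ?_⟩
  have : A = ⊤ := by
    rw [eq_top_iff, ← adjoin_range_X, Algebra.adjoin_le_iff]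
    rintro _ ⟨j, rfl⟩
    exact hX j j.2
  rw [this]; trivial

theorem homog_span {n : ℕ} (S : Subalgebra ℚ (MvPolynomial (Fin n) ℚ))
    (hS : ∀ p, p ∈ S ↔ p.IsSymmetric)
    (P : Submodule S (MvPolynomial (Fin n) ℚ)) (t : Set (MvPolynomial (Fin n) ℚ))
    (htP : t ⊆ P) (hth : ∀ b ∈ t, ∃ e, b.IsHomogeneous e)
    (I : Ideal S) (hI : ∀ s ∈ I, coeff 0 (s : MvPolynomial (Fin n) ℚ) = 0)
    (hspan : ∀ p : MvPolynomial (Fin n) ℚ, ∃ a ∈ Submodule.span ℚ t,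
      p - a ∈ I • (⊤ : Submodule S (MvPolynomial (Fin n) ℚ))) : P = ⊤ := by
  have hq : ∀ (c : ℚ) (y : MvPolynomial (Fin n) ℚ), y ∈ P → c • y ∈ P := fun c y hy =>
    (P.restrictScalars ℚ).smul_mem c hy
  have key : ∀ d (f : MvPolynomial (Fin n) ℚ), f.IsHomogeneous d → f ∈ P := by
    intro d
    induction d using Nat.strong_induction_on with
    | _ d ih =>
    intro f hf
    obtain ⟨a, ha, hg⟩ := hspan f
    have h1 : homogeneousComponent d a ∈ P := by
      clear hg
      induction ha using Submodule.span_induction with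
      | mem b hb =>
        obtain ⟨e, he⟩ := hth b hb
        rw [homogeneousComponent_of_mem he]
        split_ifs
        · exact htP hb
        · exact zero_mem _
      | zero => rw [map_zero]; exact zero_mem _
      | add y z _ _ hy hz => rw [map_add]; exact add_mem hy hz
      | smul c y _ hy => rw [map_smul]; exact hq _ _ hy
    have h2 : homogeneousComponent d (f - a) ∈ P := by
      generalize f - a = g at hg
      refine Submodule.smul_induction_on (p := fun g => homogeneousComponent d g ∈ P) hg ?_ ?_
      · intro s hs r _
        rw [Algebra.smul_def]
        change homogeneousComponent d ((s : MvPolynomial (Fin n) ℚ) * r) ∈ P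
        rw [← sum_homogeneousComponent (s : MvPolynomial (Fin n) ℚ),
          ← sum_homogeneousComponent r, Finset.sum_mul_sum, map_sum]
        refine Submodule.sum_mem _ fun i _ => ?_
        rw [map_sum]
        refine Submodule.sum_mem _ fun j _ => ?_
        rw [homogeneousComponent_of_mem ((homogeneousComponent_isHomogeneous i _).mul
          (homogeneousComponent_isHomogeneous j _))]
        split_ifs with hd
        · rcases Nat.eq_zero_or_pos i with rfl | hi
          · rw [homogeneousComponent_zero, hI s hs, C_0, zero_mul]; exact zero_mem _
          · have hsi : homogeneousComponent i (s : MvPolynomial (Fin n) ℚ) ∈ S := by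
              rw [hS]
              intro e
              have := (hS _).1 s.2 e
              rw [rename_homogeneousComponent, this]
            exact P.smul_mem ⟨_, hsi⟩ (ih j (by omega) _ (homogeneousComponent_isHomogeneous j _))
        · exact zero_mem _
      · intro y z hy hz
        rw [map_add]; exact add_mem hy hz
    have := add_mem h1 h2
    rwa [← map_add, add_sub_cancel, homogeneousComponent_of_mem hf, if_pos rfl] at this
  rw [eq_top_iff]
  intro p _
  rw [← sum_homogeneousComponent p]
  exact Submodule.sum_mem _ fun i _ => key i _ (homogeneousComponent_isHomogeneous i _)

theorem homog_basis {n : ℕ} (S : Subalgebra ℚ (MvPolynomial (Fin n) ℚ))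
    (hS : ∀ p, p ∈ S ↔ p.IsSymmetric)
    (π : MvPolynomial (Fin n) ℚ →ₗ[S] MvPolynomial (Fin n) ℚ) (hπ : ∀ p, π (π p) = π p)
    (hh : ∀ d f, f.IsHomogeneous d → (π f).IsHomogeneous d) :
    ∃ t : Finset (MvPolynomial (Fin n) ℚ), t.card ≤ n ! ∧
      Submodule.span S (t : Set (MvPolynomial (Fin n) ℚ)) = ⊤ ∧ ∀ b ∈ t, π b = b ∨ π b = 0 := by
  classical
  obtain ⟨T, hT, hTs⟩ := span_all S hS
  let I : Ideal S := RingHom.ker ((constantCoeff (R := ℚ) (σ := Fin n)).comp (algebraMap S (MvPolynomial (Fin n) ℚ)))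
  have hI : ∀ s, s ∈ I ↔ coeff 0 (s : MvPolynomial (Fin n) ℚ) = 0 := fun s => Iff.rfl
  let J : Submodule ℚ (MvPolynomial (Fin n) ℚ) :=
    (I • (⊤ : Submodule S (MvPolynomial (Fin n) ℚ))).restrictScalars ℚ
  have hJ : ∀ p, p ∈ J ↔ p ∈ I • (⊤ : Submodule S (MvPolynomial (Fin n) ℚ)) := fun p => Iff.rfl
  have hVT : Submodule.span ℚ ((T.image J.mkQ : Finset _) : Set (MvPolynomial (Fin n) ℚ ⧸ J)) = ⊤ := by
    rw [eq_top_iff]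
    intro v _
    obtain ⟨p, rfl⟩ := J.mkQ_surjective v
    have hp : p ∈ Submodule.span S (T : Set (MvPolynomial (Fin n) ℚ)) := by rw [hTs]; trivial
    induction hp using Submodule.span_induction with
    | mem y hy => exact Submodule.subset_span (by simpa using ⟨y, hy, rfl⟩)
    | zero => rw [map_zero]; exact zero_mem _
    | add y z _ _ hy hz => rw [map_add]; exact add_mem (hy trivial) (hz trivial)
    | smul c y _ hy =>
      set q : ℚ := coeff 0 (c : MvPolynomial (Fin n) ℚ) with hq
      have h1 : c • y = q • y + (c - algebraMap ℚ S q) • y := by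
        rw [sub_smul, algebraMap_smul]; abel
      have h2 : (c - algebraMap ℚ S q) • y ∈ J := by
        rw [hJ]
        refine Submodule.smul_mem_smul ?_ trivial
        rw [hI]
        change coeff 0 ((c : MvPolynomial (Fin n) ℚ) - C q) = 0
        simp [hq]
      rw [h1, map_add, LinearMap.map_smul J.mkQ q y]
      have h3 : J.mkQ ((c - algebraMap ℚ S q) • y) = 0 :=
        (Submodule.Quotient.mk_eq_zero J).2 h2
      rw [h3, add_zero]
      exact Submodule.smul_mem _ _ (hy trivial)
  have hfin : Module.Finite ℚ (MvPolynomial (Fin n) ℚ ⧸ J) := ⟨_, hVT⟩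
  have hdim : Module.finrank ℚ (MvPolynomial (Fin n) ℚ ⧸ J) ≤ n ! := by
    rw [← finrank_top, ← hVT]
    exact (finrank_span_finset_le_card _).trans (Finset.card_image_le.trans hT)
  let H : Set (MvPolynomial (Fin n) ℚ) := {f | (∃ d, f.IsHomogeneous d) ∧ (π f = f ∨ π f = 0)}
  have hH : Submodule.span ℚ H = ⊤ := by
    rw [eq_top_iff]
    intro p _
    rw [← sum_homogeneousComponent p]
    refine Submodule.sum_mem _ fun i _ => ?_
    have hi := homogeneousComponent_isHomogeneous i p
    generalize homogeneousComponent i p = f at hi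
    rw [← add_sub_cancel (π f) f]
    refine add_mem (Submodule.subset_span ⟨⟨i, hh _ _ hi⟩, Or.inl (hπ f)⟩)
      (Submodule.subset_span ⟨⟨i, hi.sub (hh _ _ hi)⟩, Or.inr ?_⟩)
    rw [map_sub, hπ, sub_self]
  obtain ⟨b, hbH, hbs, hbl⟩ := exists_linearIndependent ℚ (J.mkQ '' H)
  have hbtop : Submodule.span ℚ b = ⊤ := by
    rw [hbs, ← Submodule.map_span, hH, Submodule.map_top, Submodule.range_mkQ]
  have : Fintype b := @Fintype.ofFinite _ hbl.finite
  have hbcard : Fintype.card b ≤ n ! := hbl.fintype_card_le_finrank.trans hdim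
  choose l hlH hl using fun v : b => hbH v.2
  refine ⟨Finset.univ.image l, Finset.card_image_le.trans hbcard, ?_, ?_⟩
  · refine homog_span S hS _ (Set.range l) ?_ ?_ I (fun s hs => (hI s).1 hs) ?_
    · simp
    · rintro _ ⟨v, rfl⟩
      exact (hlH v).1
    · intro p
      have hp : J.mkQ p ∈ Submodule.span ℚ b := by rw [hbtop]; trivial
      have hb' : b = J.mkQ '' Set.range l := by
        ext v
        constructor
        · intro hv; exact ⟨_, ⟨⟨v, hv⟩, rfl⟩, hl _⟩
        · rintro ⟨_, ⟨w, rfl⟩, rfl⟩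
          rw [hl]; exact w.2
      rw [hb', ← Submodule.map_span] at hp
      obtain ⟨a, ha, hap⟩ := hp
      refine ⟨a, ha, ?_⟩
      rw [← hJ, ← Submodule.ker_mkQ J, LinearMap.mem_ker, map_sub, hap, sub_self]
  · intro y hy
    obtain ⟨v, -, rfl⟩ := Finset.mem_image.1 hy
    exact (hlH v).2

noncomputable def reyn {n : ℕ} (S : Subalgebra ℚ (MvPolynomial (Fin n) ℚ))
    (hS : ∀ p, p ∈ S ↔ p.IsSymmetric) (G : Subgroup (Equiv.Perm (Fin n))) [Fintype G] :
    MvPolynomial (Fin n) ℚ →ₗ[S] MvPolynomial (Fin n) ℚ where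
  toFun p := (Fintype.card G : ℚ)⁻¹ • ∑ g : G, rename (g : Equiv.Perm (Fin n)) p
  map_add' p q := by simp [Finset.sum_add_distrib]
  map_smul' s p := by
    simp only [Algebra.smul_def (s : S), map_mul, RingHom.id_apply]
    rw [mul_smul_comm, Finset.mul_sum]
    congr 1
    refine Finset.sum_congr rfl fun g _ => ?_
    congr 1
    exact (hS _).1 s.2 g

theorem main_aux {n : ℕ} (S : Subalgebra ℚ (MvPolynomial (Fin n) ℚ))
    (hS : ∀ p, p ∈ S ↔ p.IsSymmetric) (G : Subgroup (Equiv.Perm (Fin n))) :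
    ∃ η : Fin (n ! / Nat.card G) → MvPolynomial (Fin n) ℚ,
      LinearIndependent S η ∧
      ∀ p, p ∈ invariantSubalgebra n G ↔ p ∈ Submodule.span S (Set.range η) := by
  classical
  let π := reyn S hS G
  have hπdef : ∀ p, π p = (Fintype.card G : ℚ)⁻¹ • ∑ g : G, rename (g : Equiv.Perm (Fin n)) p :=
    fun _ => rfl
  have hfix : ∀ p, p ∈ invariantSubalgebra n G → π p = p := by
    intro p hp
    rw [mem_inv] at hp
    rw [hπdef, Finset.sum_congr rfl fun (g : G) _ => hp g g.2]
    rw [Finset.sum_const, Finset.card_univ, ← Nat.cast_smul_eq_nsmul ℚ, smul_smul,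
      inv_mul_cancel₀ (by simp), one_smul]
  have hmem : ∀ p, π p ∈ invariantSubalgebra n G := by
    intro p
    rw [mem_inv]
    intro g hg
    rw [hπdef, map_smul, map_sum]
    congr 1
    simp only [rename_rename]
    exact Fintype.sum_equiv (Equiv.mulLeft (⟨g, hg⟩ : G)) _ _ fun h => rfl
  obtain ⟨t, htc, hts, htπ⟩ := homog_basis S hS π (fun p => hfix _ (hmem p)) (by
    intro d f hf
    rw [hπdef, smul_eq_C_mul]
    rw [← zero_add d]
    exact (isHomogeneous_C _ _).mul (IsHomogeneous.sum _ _ _ fun g _ => hf.rename_isHomogeneous))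
  have hti : LinearIndependent S ((↑) : t → MvPolynomial (Fin n) ℚ) := by
    apply indep_of_span
    · simpa using hts
    · rw [finrank_sym S hS]; simpa using htc
  let N := t.filter (fun b => π b = b)
  have hNi : LinearIndependent S ((↑) : N → MvPolynomial (Fin n) ℚ) :=
    hti.comp (fun b : N => (⟨b.1, (Finset.mem_filter.1 b.2).1⟩ : t))
      (fun a b h => Subtype.ext (congrArg (fun x : t => x.1) h))
  have hNs : ∀ p, p ∈ invariantSubalgebra n G ↔
      p ∈ Submodule.span S (N : Set (MvPolynomial (Fin n) ℚ)) := by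
    intro p
    constructor
    · intro hp
      rw [← hfix p hp]
      have : p ∈ Submodule.span S (t : Set (MvPolynomial (Fin n) ℚ)) := by rw [hts]; trivial
      clear hp
      induction this using Submodule.span_induction with
      | mem y hy =>
        rcases htπ y hy with h | h
        · rw [h]
          exact Submodule.subset_span (Finset.mem_coe.2 (Finset.mem_filter.2 ⟨hy, h⟩))
        · rw [h]; exact zero_mem _
      | zero => rw [map_zero]; exact zero_mem _
      | add y z _ _ hy hz => rw [map_add]; exact add_mem hy hz
      | smul c y _ hy => rw [map_smul]; exact Submodule.smul_mem _ _ hy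
    · intro hp
      have : π p = p := by
        induction hp using Submodule.span_induction with
        | mem y hy => exact (Finset.mem_filter.1 hy).2
        | zero => rw [map_zero]
        | add y z _ _ hy hz => rw [map_add, hy, hz]
        | smul c y _ hy => rw [map_smul, hy]
      rw [← this]; exact hmem p
  have hcard : N.card = n ! / Nat.card G := by
    have hle : S ≤ invariantSubalgebra n G := fun s hs => mem_inv.2 fun g _ => (hS s).1 hs g
    let : Algebra S (invariantSubalgebra n G) := (Subalgebra.inclusion hle).toAlgebra
    have : IsScalarTower S (invariantSubalgebra n G) (MvPolynomial (Fin n) ℚ) :=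
      IsScalarTower.of_algebraMap_eq fun _ => rfl
    have h1 := Module.finrank_mul_finrank' (R := S) (S := invariantSubalgebra n G)
      (MvPolynomial (Fin n) ℚ)
    rw [finrank_sym S hS, finrank_inv G _ fun p => mem_inv] at h1
    let ψ := (IsScalarTower.toAlgHom S (invariantSubalgebra n G)
      (MvPolynomial (Fin n) ℚ)).toLinearMap
    have hψ : Function.Injective ψ := Subtype.val_injective
    have h2 := LinearMap.finrank_range_of_inj hψ
    have h3 : LinearMap.range ψ = Submodule.span S (N : Set (MvPolynomial (Fin n) ℚ)) := by
      ext p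
      rw [← hNs]
      constructor
      · rintro ⟨x, rfl⟩; exact x.2
      · intro hp; exact ⟨⟨p, hp⟩, rfl⟩
    rw [h3, finrank_span_finset_eq_card hNi] at h2
    rw [h2, ← h1, Nat.mul_div_cancel _ Nat.card_pos]
  let e : Fin (n ! / Nat.card G) ≃ N := (Fintype.equivFinOfCardEq (by simpa using hcard)).symm
  refine ⟨fun i => (e i : MvPolynomial (Fin n) ℚ), hNi.comp _ e.injective, fun p => ?_⟩
  rw [hNs]
  have : Set.range (fun i => (e i : MvPolynomial (Fin n) ℚ)) = N := by
    ext y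
    constructor
    · rintro ⟨i, rfl⟩; exact (e i).2
    · intro hy; exact ⟨e.symm ⟨y, hy⟩, by simp⟩
  rw [this]

theorem invariant_ring_free_over_symmetric (n : ℕ) (hn : 0 < n)
    (G : Subgroup (Equiv.Perm (Fin n))) :
    ∃ η : Fin (n ! / Nat.card G) → MvPolynomial (Fin n) ℚ,
      (∀ i, η i ∈ invariantSubalgebra n G) ∧
      ∀ p ∈ invariantSubalgebra n G,
        ∃! c : Fin (n ! / Nat.card G) →
            ↥(Algebra.adjoin ℚ (Set.range fun k : Fin n => esymm (Fin n) ℚ ((k : ℕ) + 1))),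
          p = ∑ i, (c i : MvPolynomial (Fin n) ℚ) * η i := by
  obtain ⟨η, hi, hs⟩ := main_aux _ (fun p => mem_adj) G
  refine ⟨η, fun i => (hs _).2 (Submodule.subset_span ⟨i, rfl⟩), fun p hp => ?_⟩
  obtain ⟨c, hc⟩ := (Submodule.mem_span_range_iff_exists_fun _).1 ((hs p).1 hp)
  refine ⟨c, hc.symm, fun c' hc' => ?_⟩
  funext i
  exact Fintype.linearIndependent_iffₛ.1 hi c' c (hc'.symm.trans hc.symm) i
end

section
/- Let n be a positive integer and let G be a subgroup of the symmetric group S_n acting on ℚ[x_1,...,x_n] by permuting the variables. Then the quotient ℚ[x_1,...,x_n]^G / ((e_1,...,e_n) · ℚ[x_1,...,x_n]^G) of the invariant ring by the ideal generated in it by the elementary symmetric polynomials e_1,...,e_n is a ℚ-vector space of dimension n!/|G|. -/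
open MvPolynomial Nat

theorem span_aux {R : Type} [CommRing R] : ∀ (n : ℕ) (S : Type) [CommRing S] [Algebra S R]
    (x : Fin n → R) (P : Polynomial S), P.Monic → P.natDegree = n →
    P.map (algebraMap S R) = ∏ i, (Polynomial.X - Polynomial.C (x i)) →
    Algebra.adjoin S (Set.range x) = ⊤ →
    ∃ s : Finset R, s.card ≤ n ! ∧ Submodule.span S (s : Set R) = ⊤ := by
  classical
  intro n
  induction n with
  | zero =>
    intro S _ _ x P _ _ _ hx
    refine ⟨{1}, by simp, ?_⟩
    rw [Set.range_eq_empty, Algebra.adjoin_empty] at hx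
    rw [Finset.coe_singleton, ← Submodule.one_eq_span, ← Algebra.toSubmodule_bot, hx]
    simp
  | succ n ih =>
    intro S _ _ x P hm hd hP hx
    let T := Algebra.adjoin S {x 0}
    let t : T := ⟨x 0, Algebra.subset_adjoin rfl⟩
    have hroot : Polynomial.aeval (x 0) P = 0 := by
      rw [Polynomial.aeval_def, ← Polynomial.eval_map, hP, Polynomial.eval_prod]
      exact Finset.prod_eq_zero (Finset.mem_univ 0) (by simp)
    have hinj : Function.Injective (algebraMap T R) := Subtype.val_injective
    have hroot' : Polynomial.aeval t P = 0 := by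
      apply hinj
      rw [← Polynomial.aeval_algebraMap_apply, map_zero]
      exact hroot
    obtain ⟨PT, hPT⟩ : ∃ PT, PT = P.map (algebraMap S T) := ⟨_, rfl⟩
    have hPTm : PT.Monic := hPT ▸ hm.map _
    have hr : PT.IsRoot t := by
      rw [hPT, Polynomial.IsRoot, Polynomial.eval_map, ← Polynomial.aeval_def, hroot']
    obtain ⟨P', hmul⟩ : ∃ P', (Polynomial.X - Polynomial.C t) * P' = PT :=
      ⟨PT /ₘ (Polynomial.X - Polynomial.C t), Polynomial.mul_divByMonic_eq_iff_isRoot.mpr hr⟩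
    have hm' : P'.Monic := (Polynomial.monic_X_sub_C t).of_mul_monic_left (hmul ▸ hPTm)
    obtain hsub | hnt := subsingleton_or_nontrivial R
    · exact ⟨∅, by simp, Subsingleton.elim _ _⟩
    have hntT : Nontrivial T := inferInstance
    have hd' : P'.natDegree = n := by
      have h1 := (Polynomial.monic_X_sub_C t).natDegree_mul hm'
      rw [hmul, hPT, hm.natDegree_map, hd, Polynomial.natDegree_X_sub_C] at h1
      omega
    have hP' : P'.map (algebraMap T R) = ∏ i, (Polynomial.X - Polynomial.C (x (Fin.succ i))) := by
      apply (Polynomial.monic_X_sub_C (x 0)).isRegular.left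
      simp only
      rw [← Fin.prod_univ_succ (fun i => Polynomial.X - Polynomial.C (x i)), ← hP]
      have := congrArg (Polynomial.map (algebraMap T R)) hmul
      rw [Polynomial.map_mul, Polynomial.map_sub, Polynomial.map_X, Polynomial.map_C, hPT,
        Polynomial.map_map, ← IsScalarTower.algebraMap_eq] at this
      exact this
    have hx' : Algebra.adjoin T (Set.range (fun i : Fin n => x i.succ)) = ⊤ := by
      have h2 : Set.range x = {x 0} ∪ Set.range (fun i : Fin n => x i.succ) := by
        rw [Fin.range_fin_succ]; rfl
      rw [h2, Algebra.adjoin_union_eq_adjoin_adjoin] at hx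
      apply_fun (Subalgebra.restrictScalars S) using Subalgebra.restrictScalars_injective S
      rw [hx, Subalgebra.restrictScalars_top]
    obtain ⟨s, hs, hs'⟩ := ih T _ P' hm' hd' hP' hx'
    have hspanT : Submodule.span S ((Finset.image (t ^ ·) (Finset.range (n+1)) : Finset T) : Set T) = ⊤ := by
      have h3 : Submodule.span S ((t ^ ·) '' (Finset.range (n+1) : Set ℕ)) =
          Subalgebra.toSubmodule (Algebra.adjoin S {t}) := by
        rw [← hd, ← Submodule.span_range_natDegree_eq_adjoin hm hroot']
        congr 1
        ext y
        simp
      rw [Finset.coe_image, h3]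
      have : ({t} : Set T) = (((↑) : T → R) ⁻¹' {x 0}) := by
        ext y; simp [Subtype.ext_iff, t]
      rw [this, Algebra.adjoin_adjoin_coe_preimage, Algebra.top_toSubmodule]
    refine ⟨Finset.image₂ (fun (a : T) (b : R) => a • b) (Finset.image (t ^ ·) (Finset.range (n+1))) s, ?_, ?_⟩
    · refine (Finset.card_image₂_le _ _ _).trans ?_
      rw [Nat.factorial_succ]
      exact Nat.mul_le_mul (Finset.card_image_le.trans (by simp)) hs
    · rw [Finset.coe_image₂, Set.image2_smul, Submodule.span_smul_of_span_eq_top hspanT, hs', Submodule.restrictScalars_top]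

open TensorProduct in
theorem key_aux {S A : Type} [CommRing S] [IsDomain S] [CommRing A] [Algebra S A]
    [Module.Finite S A] [Module.Flat S A] [Algebra S ℚ]
    (hs : Function.Surjective (algebraMap S ℚ)) (I : Ideal A)
    (hI : I = (RingHom.ker (algebraMap S ℚ)).map (algebraMap S A))
    [Module ℚ (A ⧸ I)] : Module.finrank ℚ (A ⧸ I) = Module.finrank S A := by
  let p : PrimeSpectrum S := (⊥ : PrimeSpectrum ℚ).comap (algebraMap S ℚ)
  have h1 : Module.finrank ℚ (ℚ ⊗[S] A) = Module.finrank S A := by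
    have := Module.rankAtStalk_baseChange (R := S) (M := A) (S := ℚ) ⊥
    rw [Module.rankAtStalk_eq_finrank_of_free] at this
    rw [← p.asIdeal.finrank_fiber_eq_finrank, p.asIdeal.finrank_fiber_eq_rankAtStalk]
    exact this
  rw [← h1]
  let e1 : (A ⧸ I) ≃+ (A ⧸ (RingHom.ker (algebraMap S ℚ)).map (algebraMap S A)) :=
    (Ideal.quotEquivOfEq hI).toAddEquiv
  let e2 := (Algebra.TensorProduct.quotIdealMapEquivTensorQuot A (RingHom.ker (algebraMap S ℚ))).toAddEquiv
  let e0 : (S ⧸ (RingHom.ker (algebraMap S ℚ))) ≃ₐ[S] ℚ :=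
    Ideal.quotientKerAlgEquivOfSurjective (f := Algebra.ofId S ℚ) hs
  let e3 := (TensorProduct.congr (LinearEquiv.refl S A) e0.toLinearEquiv ≪≫ₗ TensorProduct.comm S A ℚ).toAddEquiv
  let e := (e1.trans e2).trans e3
  exact LinearEquiv.finrank_eq (LinearEquiv.ofBijective e.toAddMonoidHom.toRatLinearMap e.bijective)

noncomputable instance permAct_s5 (n : ℕ) :
    MulSemiringAction (Equiv.Perm (Fin n)) (MvPolynomial (Fin n) ℚ) where
  smul g p := rename (⇑g) p
  one_smul p := by
    change rename (⇑(1 : Equiv.Perm (Fin n))) p = p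
    rw [Equiv.Perm.coe_one, rename_id_apply]
  mul_smul g h p := by
    change rename (⇑(g * h)) p = rename (⇑g) (rename (⇑h) p)
    rw [rename_rename, Equiv.Perm.coe_mul]
  smul_zero g := map_zero (rename (⇑g))
  smul_add g := map_add (rename (⇑g))
  smul_one g := map_one (rename (⇑g))
  smul_mul g := map_mul (rename (⇑g))

theorem permAct_def {n : ℕ} (g : Equiv.Perm (Fin n)) (p : MvPolynomial (Fin n) ℚ) :
    g • p = rename (⇑g) p := rfl

instance permFaithful (n : ℕ) : FaithfulSMul (Equiv.Perm (Fin n)) (MvPolynomial (Fin n) ℚ) where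
  eq_of_smul_eq_smul := by
    intro g h H
    ext1 i
    have := H (X i)
    rw [permAct_def, permAct_def, rename_X, rename_X] at this
    exact X_injective this

instance galS (n : ℕ) : IsGaloisGroup (Equiv.Perm (Fin n)) (symmetricSubalgebra (Fin n) ℚ)
    (MvPolynomial (Fin n) ℚ) where
  faithful := inferInstance
  commutes := ⟨fun g s p => by
    rw [Algebra.smul_def, Algebra.smul_def, smul_mul']
    congr 1
    exact s.2 g⟩
  isInvariant := ⟨fun b hb => ⟨⟨b, hb⟩, rfl⟩⟩

instance galG (n : ℕ) (G : Subgroup (Equiv.Perm (Fin n))) : IsGaloisGroup G (invariantSubalgebra n G)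
    (MvPolynomial (Fin n) ℚ) where
  faithful := inferInstance
  commutes := ⟨fun g s p => by
    rw [Algebra.smul_def, Algebra.smul_def, smul_mul']
    congr 1
    exact mem_inv.1 s.2 g g.2⟩
  isInvariant := ⟨fun b hb => ⟨⟨b, mem_inv.2 fun g hg => hb ⟨g, hg⟩⟩, rfl⟩⟩

theorem finrankS (n : ℕ) :
    Module.finrank (symmetricSubalgebra (Fin n) ℚ) (MvPolynomial (Fin n) ℚ) = n ! := by
  rw [← IsGaloisGroup.card_eq_finrank' (Equiv.Perm (Fin n)), Nat.card_perm, Nat.card_fin]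

theorem freeS (n : ℕ) :
    Module.Finite (symmetricSubalgebra (Fin n) ℚ) (MvPolynomial (Fin n) ℚ) ∧
    Module.Free (symmetricSubalgebra (Fin n) ℚ) (MvPolynomial (Fin n) ℚ) := by
  set S := symmetricSubalgebra (Fin n) ℚ
  obtain ⟨Q, hQ⟩ : ∃ Q : Polynomial (MvPolynomial (Fin n) ℚ),
    Q = ∏ i, (Polynomial.X - Polynomial.C (X i)) := ⟨_, rfl⟩
  have hQm : Q.Monic := hQ ▸ Polynomial.monic_prod_of_monic _ _ fun i _ => Polynomial.monic_X_sub_C _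
  have hQd : Q.natDegree = n := by
    rw [hQ, Polynomial.natDegree_prod_of_monic _ _ fun i _ => Polynomial.monic_X_sub_C _]
    simp
  have hQl : Q ∈ Polynomial.lifts (algebraMap S (MvPolynomial (Fin n) ℚ)) := by
    rw [Polynomial.lifts_iff_coeff_lifts]
    intro k
    refine ⟨⟨Q.coeff k, fun g => ?_⟩, rfl⟩
    have : Q.map (rename (⇑g) : MvPolynomial (Fin n) ℚ →ₐ[ℚ] MvPolynomial (Fin n) ℚ).toRingHom = Q := by
      rw [hQ, Polynomial.map_prod]
      simp only [Polynomial.map_sub, Polynomial.map_X, Polynomial.map_C]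
      refine Eq.trans ?_ (Equiv.prod_comp g fun i => Polynomial.X - Polynomial.C (X i))
      refine Finset.prod_congr rfl fun i _ => ?_
      congr 2
      exact rename_X _ _
    conv_rhs => rw [← this, Polynomial.coeff_map]
    rfl
  obtain ⟨P, hP, hPd, hPm⟩ := Polynomial.lifts_and_natDegree_eq_and_monic hQl hQm
  have hadj : Algebra.adjoin S (Set.range (X : Fin n → MvPolynomial (Fin n) ℚ)) = ⊤ := by
    rw [eq_top_iff]
    intro p _
    have h1 : p ∈ Algebra.adjoin ℚ (Set.range (X : Fin n → MvPolynomial (Fin n) ℚ)) := by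
      rw [adjoin_range_X]; trivial
    have h2 : Algebra.adjoin ℚ (Set.range (X : Fin n → MvPolynomial (Fin n) ℚ)) ≤
        (Algebra.adjoin S (Set.range (X : Fin n → MvPolynomial (Fin n) ℚ))).restrictScalars ℚ :=
      Algebra.adjoin_le Algebra.subset_adjoin
    exact h2 h1
  obtain ⟨s, hs, hs'⟩ := span_aux n S X P hPm (hPd.trans hQd) (hP.trans hQ) hadj
  have hli : LinearIndependent S (fun i : s => (i : MvPolynomial (Fin n) ℚ)) := by
    apply linearIndependent_of_top_le_span_of_card_le_finrank
    · simp [hs']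
    · rw [finrankS]; simpa using hs
  exact ⟨⟨⟨s, hs'⟩⟩, Module.Free.of_basis (Module.Basis.mk hli (by simp [hs']))⟩

theorem constantCoeff_esymm (n k : ℕ) (hk : 1 ≤ k) :
    constantCoeff (esymm (Fin n) ℚ k) = 0 := by
  rw [esymm, map_sum]
  refine Finset.sum_eq_zero fun t ht => ?_
  rw [map_prod]
  have hc := (Finset.mem_powersetCard.1 ht).2
  obtain ⟨i, hi⟩ : t.Nonempty := Finset.card_pos.1 (by omega)
  exact Finset.prod_eq_zero hi (constantCoeff_X _ i)

theorem sym_le_inv (n : ℕ) (G : Subgroup (Equiv.Perm (Fin n))) :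
    symmetricSubalgebra (Fin n) ℚ ≤ invariantSubalgebra n G :=
  fun _ hp => mem_inv.2 fun g _ => hp g

noncomputable instance algSA (n : ℕ) (G : Subgroup (Equiv.Perm (Fin n))) :
    Algebra (symmetricSubalgebra (Fin n) ℚ) (invariantSubalgebra n G) :=
  (Subalgebra.inclusion (sym_le_inv n G)).toRingHom.toAlgebra

instance towerSAR (n : ℕ) (G : Subgroup (Equiv.Perm (Fin n))) :
    IsScalarTower (symmetricSubalgebra (Fin n) ℚ) (invariantSubalgebra n G)
      (MvPolynomial (Fin n) ℚ) := IsScalarTower.of_algebraMap_eq fun _ => rfl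

noncomputable def reynolds (n : ℕ) (G : Subgroup (Equiv.Perm (Fin n))) :
    MvPolynomial (Fin n) ℚ →ₗ[symmetricSubalgebra (Fin n) ℚ] invariantSubalgebra n G where
  toFun p := ⟨(Nat.card G : ℚ)⁻¹ • ∑ᶠ g : G, rename (⇑(g : Equiv.Perm (Fin n))) p, by
    rw [mem_inv]
    intro h hh
    have := Fintype.ofFinite G
    rw [finsum_eq_sum_of_fintype, map_smul, map_sum]
    congr 1
    refine Eq.trans ?_ (Equiv.sum_comp (Equiv.mulLeft (⟨h, hh⟩ : G))
      fun g : G => rename (⇑(g : Equiv.Perm (Fin n))) p)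
    refine Finset.sum_congr rfl fun g _ => ?_
    rw [rename_rename]
    rfl⟩
  map_add' p q := by
    have := Fintype.ofFinite G
    ext1
    simp only [finsum_eq_sum_of_fintype, map_add, Finset.sum_add_distrib, smul_add]
    rfl
  map_smul' s p := by
    have := Fintype.ofFinite G
    ext1
    change (Nat.card G : ℚ)⁻¹ • (∑ᶠ g : G, rename (⇑(g : Equiv.Perm (Fin n)))
      ((s : MvPolynomial (Fin n) ℚ) * p)) = (s : MvPolynomial (Fin n) ℚ) * ((Nat.card G : ℚ)⁻¹ •
      ∑ᶠ g : G, rename (⇑(g : Equiv.Perm (Fin n))) p)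
    rw [finsum_eq_sum_of_fintype, finsum_eq_sum_of_fintype]
    rw [mul_smul_comm, Finset.mul_sum]
    refine congrArg _ (Finset.sum_congr rfl fun g _ => ?_)
    rw [map_mul]
    exact congrArg (· * _) (s.2 g)

theorem reynolds_incl (n : ℕ) (G : Subgroup (Equiv.Perm (Fin n))) (a : invariantSubalgebra n G) :
    reynolds n G (a : MvPolynomial (Fin n) ℚ) = a := by
  have := Fintype.ofFinite G
  ext1
  change (Nat.card G : ℚ)⁻¹ • ∑ᶠ g : G, rename (⇑(g : Equiv.Perm (Fin n))) (a : MvPolynomial (Fin n) ℚ) = _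
  rw [finsum_eq_sum_of_fintype, Finset.sum_congr rfl fun g _ => mem_inv.1 a.2 g.1 g.2,
    Finset.sum_const, Finset.card_univ, ← Nat.card_eq_fintype_card, ← Nat.cast_smul_eq_nsmul ℚ,
    smul_smul, inv_mul_cancel₀ (by exact_mod_cast Nat.card_pos.ne'), one_smul]

theorem projA (n : ℕ) (G : Subgroup (Equiv.Perm (Fin n))) :
    Module.Finite (symmetricSubalgebra (Fin n) ℚ) (invariantSubalgebra n G) ∧
    Module.Projective (symmetricSubalgebra (Fin n) ℚ) (invariantSubalgebra n G) := by
  obtain ⟨h1, h2⟩ := freeS n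
  refine ⟨Module.Finite.of_surjective (reynolds n G) fun a => ⟨a, reynolds_incl n G a⟩, ?_⟩
  exact Module.Projective.of_split
    (IsScalarTower.toAlgHom (symmetricSubalgebra (Fin n) ℚ) (invariantSubalgebra n G)
      (MvPolynomial (Fin n) ℚ)).toLinearMap (reynolds n G)
    (LinearMap.ext fun a => reynolds_incl n G a)

theorem finrankA (n : ℕ) (G : Subgroup (Equiv.Perm (Fin n))) :
    Module.finrank (symmetricSubalgebra (Fin n) ℚ) (invariantSubalgebra n G) = n ! / Nat.card G := by
  have h := Module.finrank_mul_finrank' (R := symmetricSubalgebra (Fin n) ℚ)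
    (S := invariantSubalgebra n G) (T := MvPolynomial (Fin n) ℚ)
  rw [finrankS, ← IsGaloisGroup.card_eq_finrank' G (invariantSubalgebra n G)] at h
  exact (Nat.div_eq_of_eq_mul_left Nat.card_pos h.symm).symm

/-- The quotient of the invariant ring `ℚ[x₁,…,xₙ]^G` by the ideal generated in it by the
elementary symmetric polynomials `e₁, …, eₙ` is a `ℚ`-vector space of dimension `n!/|G|`. -/
theorem invariant_ring_quotient_finrank (n : ℕ) (hn : 0 < n)
    (G : Subgroup (Equiv.Perm (Fin n))) :
    Module.finrank ℚ
      (↥(invariantSubalgebra n G) ⧸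
        Ideal.span {x : ↥(invariantSubalgebra n G) |
          ∃ k, 1 ≤ k ∧ k ≤ n ∧ (x : MvPolynomial (Fin n) ℚ) = esymm (Fin n) ℚ k}) =
      n ! / Nat.card G := by
  obtain ⟨h1, h2⟩ := projA n G
  let c : symmetricSubalgebra (Fin n) ℚ →ₐ[ℚ] ℚ :=
    (aeval (fun _ => (0 : ℚ))).comp (symmetricSubalgebra (Fin n) ℚ).val
  let : Algebra (symmetricSubalgebra (Fin n) ℚ) ℚ := c.toRingHom.toAlgebra
  have hc : ∀ s, algebraMap (symmetricSubalgebra (Fin n) ℚ) ℚ s = c s := fun _ => rfl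
  have hcc : ∀ s, c s = constantCoeff (s : MvPolynomial (Fin n) ℚ) := fun s => by
    simp [c, constantCoeff_eq]
  rw [← finrankA n G]
  refine key_aux (fun q => ⟨algebraMap ℚ _ q, by rw [hc, AlgHom.commutes]; rfl⟩) _ ?_
  set I := Ideal.span {x : ↥(invariantSubalgebra n G) |
          ∃ k, 1 ≤ k ∧ k ≤ n ∧ (x : MvPolynomial (Fin n) ℚ) = esymm (Fin n) ℚ k} with hI
  apply le_antisymm
  · rw [hI, Ideal.span_le]
    rintro x ⟨k, hk, hkn, hx⟩
    have : x = algebraMap (symmetricSubalgebra (Fin n) ℚ) (invariantSubalgebra n G)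
        ⟨esymm (Fin n) ℚ k, esymm_isSymmetric _ _ _⟩ := Subtype.ext hx
    rw [this]
    apply Ideal.mem_map_of_mem
    rw [RingHom.mem_ker, hc, hcc, constantCoeff_esymm n k hk]
  · rw [Ideal.map_le_iff_le_comap]
    intro s hs
    rw [RingHom.mem_ker, hc] at hs
    obtain ⟨p, rfl⟩ := (esymmAlgHom_fin_bijective ℚ n).2 s
    let φ₁ : MvPolynomial (Fin n) ℚ →ₐ[ℚ] (invariantSubalgebra n G ⧸ I) :=
      (Ideal.Quotient.mkₐ ℚ I).comp ((Subalgebra.inclusion (sym_le_inv n G)).comp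
        (esymmAlgHom (Fin n) ℚ n))
    let φ₂ : MvPolynomial (Fin n) ℚ →ₐ[ℚ] (invariantSubalgebra n G ⧸ I) :=
      (Algebra.ofId ℚ _).comp (c.comp (esymmAlgHom (Fin n) ℚ n))
    have hφ : φ₁ = φ₂ := by
      apply MvPolynomial.algHom_ext
      intro i
      have hX : ((esymmAlgHom (Fin n) ℚ n (X i) : symmetricSubalgebra (Fin n) ℚ) :
          MvPolynomial (Fin n) ℚ) = esymm (Fin n) ℚ (i + 1) := by
        rw [esymmAlgHom_apply, aeval_X]
      have e1 : φ₁ (X i) = 0 := by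
        change Ideal.Quotient.mk I _ = 0
        rw [Ideal.Quotient.eq_zero_iff_mem]
        exact Ideal.subset_span ⟨i + 1, by omega, i.2, hX⟩
      have e2 : φ₂ (X i) = 0 := by
        change Algebra.ofId ℚ (invariantSubalgebra n G ⧸ I) (c (esymmAlgHom (Fin n) ℚ n (X i))) = 0
        rw [hcc, hX, constantCoeff_esymm n _ (by omega), map_zero]
      rw [e1, e2]
    rw [Ideal.mem_comap, ← Ideal.Quotient.eq_zero_iff_mem]
    change φ₁ p = 0
    rw [hφ]
    change Algebra.ofId ℚ (invariantSubalgebra n G ⧸ I) (c (esymmAlgHom (Fin n) ℚ n p)) = 0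
    rw [hs, map_zero]
end
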